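/- arXiv:0912.3366 — 4 statements merged into one kernel-verified Lean document; each statement's English description precedes it below -/
import Mathlib

section
/- Let f ∈ S'(ℝ^d) and φ₁, φ₂, φ₃ ∈ S(ℝ^d). Then the twisted convolution integral defining ((V_{φ₁} f) ⊛ (V_{φ₂} φ₃))(x,ξ) converges absolutely for every (x,ξ) ∈ ℝ^{2d}, and (V_{φ₁} f) ⊛ (V_{φ₂} φ₃) = (φ₃, φ₁)_{L²} · V_{φ₂} f, where (φ₃, φ₁)_{L²} = ∫_{ℝ^d} φ₃(y) conj(φ₁(y)) dy. -/
open MeasureTheory Real Complex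
open scoped RealInnerProductSpace

noncomputable section

/-- Euclidean space ℝ^d. -/
abbrev Ed (d : ℕ) := EuclideanSpace ℝ (Fin d)

/-- Japanese bracket ⟨x⟩ = (1+|x|²)^{1/2}. -/
def jap {d : ℕ} (x : Ed d) : ℝ := (1 + ‖x‖ ^ 2) ^ ((1 : ℝ) / 2)

/-- standard basis vector of ℝ^d. -/
def eVec (d : ℕ) (i : Fin d) : Ed d := EuclideanSpace.single i 1

/-- The family of directions for a mixed partial derivative ∂_x^α ∂_ξ^β :
`n` basis directions in the `x`-slot, followed by `m` basis directions in the `ξ`-slot. -/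
def dirs (d n m : ℕ) (i : Fin n → Fin d) (j : Fin m → Fin d) :
    Fin (n + m) → Ed d × Ed d :=
  Fin.addCases (fun k => (eVec d (i k), 0)) (fun k => (0, eVec d (j k)))

/-- Mixed partial derivative, as iterated Fréchet derivative applied to basis directions. -/
def mixedPartial {d : ℕ} {F : Type*} [NormedAddCommGroup F] [NormedSpace ℝ F]
    (n m : ℕ) (i : Fin n → Fin d) (j : Fin m → Fin d) (f : Ed d × Ed d → F)
    (z : Ed d × Ed d) : F :=
  iteratedFDeriv ℝ (n + m) f z (dirs d n m i j)

/-- ω is a positive, polynomially moderate weight on ℝ^{2d}, i.e. ω ∈ P(ℝ^{2d}). -/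
def IsModerateWeight {d : ℕ} (ω : Ed d × Ed d → ℝ) : Prop :=
  (∀ z, 0 < ω z) ∧
    ∃ C N : ℝ, 0 < C ∧ 0 < N ∧
      ∀ X Y : Ed d × Ed d, ω (X + Y) ≤ C * ω X * ((1 + ‖Y‖ ^ 2) ^ ((1 : ℝ) / 2)) ^ N

/-- ω ∈ P_{r,ρ}(ℝ^{2d}). -/
def InPrr {d : ℕ} (r ρ : ℝ) (ω : Ed d × Ed d → ℝ) : Prop :=
  IsModerateWeight ω ∧ ContDiff ℝ (⊤ : ℕ∞) ω ∧
    ∀ (n m : ℕ) (i : Fin n → Fin d) (j : Fin m → Fin d),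
      ∃ C : ℝ, ∀ x ξ : Ed d,
        jap x ^ (r * n) * jap ξ ^ (ρ * m) * |mixedPartial n m i j ω (x, ξ)| ≤ C * ω (x, ξ)

/-- a ∈ SG^{(ω₀)}_{r,ρ}(ℝ^{2d}). -/
def InSG {d : ℕ} (r ρ : ℝ) (ω₀ : Ed d × Ed d → ℝ) (a : Ed d × Ed d → ℂ) : Prop :=
  ContDiff ℝ (⊤ : ℕ∞) a ∧
    ∀ (n m : ℕ) (i : Fin n → Fin d) (j : Fin m → Fin d),
      ∃ C : ℝ, ∀ x ξ : Ed d,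
        ‖mixedPartial n m i j a (x, ξ)‖ ≤
          C * jap x ^ (-(r * n)) * jap ξ ^ (-(ρ * m)) * ω₀ (x, ξ)

/-- a ∈ SG^{m,μ}_{r,ρ}(ℝ^{2d}). -/
def InSGpoly {d : ℕ} (m μ r ρ : ℝ) (a : Ed d × Ed d → ℂ) : Prop :=
  InSG r ρ (fun z => jap z.1 ^ m * jap z.2 ^ μ) a

/-- Γ is an open cone in ℝ^d ∖ {0}. -/
def IsOpenCone {d : ℕ} (Γ : Set (Ed d)) : Prop :=
  IsOpen Γ ∧ (0 : Ed d) ∉ Γ ∧ ∀ x ∈ Γ, ∀ t : ℝ, 0 < t → t • x ∈ Γ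

/-- a is ψ-invertible with respect to ω₀ at (x₀, ξ₀) ∈ ℝ^d × (ℝ^d ∖ {0}). -/
def PsiInvertibleAt {d : ℕ} (ω₀ : Ed d × Ed d → ℝ) (a : Ed d × Ed d → ℂ)
    (x₀ ξ₀ : Ed d) : Prop :=
  ∃ (X Γ : Set (Ed d)) (R c : ℝ),
    IsOpen X ∧ x₀ ∈ X ∧ IsOpenCone Γ ∧ ξ₀ ∈ Γ ∧ 0 < R ∧ 0 < c ∧
      ∀ x ∈ X, ∀ ξ ∈ Γ, R ≤ ‖ξ‖ → c * ω₀ (x, ξ) ≤ ‖a (x, ξ)‖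

/-- a is e-invertible with respect to ω₀ at (x₀, ξ₀) ∈ (ℝ^d ∖ {0}) × ℝ^d. -/
def EInvertibleAt {d : ℕ} (ω₀ : Ed d × Ed d → ℝ) (a : Ed d × Ed d → ℂ)
    (x₀ ξ₀ : Ed d) : Prop :=
  ∃ (Γ X : Set (Ed d)) (R c : ℝ),
    IsOpenCone Γ ∧ x₀ ∈ Γ ∧ IsOpen X ∧ ξ₀ ∈ X ∧ 0 < R ∧ 0 < c ∧
      ∀ x ∈ Γ, R ≤ ‖x‖ → ∀ ξ ∈ X, c * ω₀ (x, ξ) ≤ ‖a (x, ξ)‖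

/-- a is ψe-invertible with respect to ω₀ at (x₀, ξ₀) ∈ (ℝ^d ∖ {0}) × (ℝ^d ∖ {0}). -/
def PsiEInvertibleAt {d : ℕ} (ω₀ : Ed d × Ed d → ℝ) (a : Ed d × Ed d → ℂ)
    (x₀ ξ₀ : Ed d) : Prop :=
  ∃ (Γ₁ Γ₂ : Set (Ed d)) (R₁ R₂ c : ℝ),
    IsOpenCone Γ₁ ∧ x₀ ∈ Γ₁ ∧ IsOpenCone Γ₂ ∧ ξ₀ ∈ Γ₂ ∧ 0 < R₁ ∧ 0 < R₂ ∧ 0 < c ∧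
      ∀ x ∈ Γ₁, R₁ ≤ ‖x‖ → ∀ ξ ∈ Γ₂, R₂ ≤ ‖ξ‖ → c * ω₀ (x, ξ) ≤ ‖a (x, ξ)‖

/-- Char^ψ_{(ω₀)}(a). -/
def CharPsi {d : ℕ} (ω₀ : Ed d × Ed d → ℝ) (a : Ed d × Ed d → ℂ) : Set (Ed d × Ed d) :=
  {p | p.2 ≠ 0 ∧ ¬ PsiInvertibleAt ω₀ a p.1 p.2}

/-- Char^e_{(ω₀)}(a). -/
def CharE {d : ℕ} (ω₀ : Ed d × Ed d → ℝ) (a : Ed d × Ed d → ℂ) : Set (Ed d × Ed d) :=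
  {p | p.1 ≠ 0 ∧ ¬ EInvertibleAt ω₀ a p.1 p.2}

/-- Char^{ψe}_{(ω₀)}(a). -/
def CharPsiE {d : ℕ} (ω₀ : Ed d × Ed d → ℝ) (a : Ed d × Ed d → ℂ) : Set (Ed d × Ed d) :=
  {p | p.1 ≠ 0 ∧ p.2 ≠ 0 ∧ ¬ PsiEInvertibleAt ω₀ a p.1 p.2}

/-- Char_{(ω₀)}(a): the full characteristic set. -/
def CharSet {d : ℕ} (ω₀ : Ed d × Ed d → ℝ) (a : Ed d × Ed d → ℂ) : Set (Ed d × Ed d) :=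
  CharPsi ω₀ a ∪ CharE ω₀ a ∪ CharPsiE ω₀ a

/-- a is SG-elliptic with respect to ω₀. -/
def SGElliptic {d : ℕ} (ω₀ : Ed d × Ed d → ℝ) (a : Ed d × Ed d → ℂ) : Prop :=
  ∃ K : Set (Ed d × Ed d), IsCompact K ∧
    ∃ c : ℝ, 0 < c ∧ ∀ z ∉ K, c * ω₀ z ≤ ‖a z‖

/-- φ ∈ C_{x₀}(X): cutoff function with respect to x₀ and X. -/
def IsCutoff {d : ℕ} (X : Set (Ed d)) (x₀ : Ed d) (φ : Ed d → ℝ) : Prop :=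
  ContDiff ℝ (⊤ : ℕ∞) φ ∧ (∀ x, 0 ≤ φ x ∧ φ x ≤ 1) ∧ HasCompactSupport φ ∧
    tsupport φ ⊆ X ∧ ∃ U : Set (Ed d), IsOpen U ∧ x₀ ∈ U ∧ ∀ x ∈ U, φ x = 1

/-- ψ ∈ C^dir_{ξ₀}(Γ): directional cutoff function with respect to ξ₀ and Γ. -/
def IsDirCutoff {d : ℕ} (Γ : Set (Ed d)) (ξ₀ : Ed d) (ψ : Ed d → ℝ) : Prop :=
  ContDiff ℝ (⊤ : ℕ∞) ψ ∧ (∀ ξ, 0 ≤ ψ ξ ∧ ψ ξ ≤ 1) ∧ Function.support ψ ⊆ Γ ∧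
    ∃ (R : ℝ) (Γ₁ : Set (Ed d)), 0 < R ∧ IsOpenCone Γ₁ ∧ Γ₁ ⊆ Γ ∧ ξ₀ ∈ Γ₁ ∧
      (∀ t : ℝ, 1 ≤ t → ∀ ξ : Ed d, R ≤ ‖ξ‖ → ψ (t • ξ) = ψ ξ) ∧
      (∀ ξ ∈ Γ₁, R ≤ ‖ξ‖ → ψ ξ = 1)

/-- The Fourier transform ĝ(ξ) = (2π)^{-d/2} ∫ g(y) e^{-i⟨y,ξ⟩} dy, as an integral. -/
def fourierInt {d : ℕ} (g : Ed d → ℂ) (ξ : Ed d) : ℂ :=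
  (((2 * π) ^ (-(d : ℝ) / 2) : ℝ) : ℂ) *
    ∫ y : Ed d, g y * Complex.exp (-(Complex.I * (⟪y, ξ⟫ : ℝ)))

/-- The Kohn–Nirenberg pseudo-differential operator
Op(a)f(x) = (2π)^{-d/2} ∫ a(x,ξ) f̂(ξ) e^{i⟨x,ξ⟩} dξ. -/
def OpKN {d : ℕ} (a : Ed d × Ed d → ℂ) (f : Ed d → ℂ) (x : Ed d) : ℂ :=
  (((2 * π) ^ (-(d : ℝ) / 2) : ℝ) : ℂ) *
    ∫ ξ : Ed d, a (x, ξ) * fourierInt f ξ * Complex.exp (Complex.I * (⟪x, ξ⟫ : ℝ))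

/-- The short-time Fourier transform
V_φ f(x,ξ) = (2π)^{-d/2} ∫ f(y) conj(φ(y−x)) e^{-i⟨y,ξ⟩} dy, as an integral. -/
def stftInt {d : ℕ} (φ f : Ed d → ℂ) (x ξ : Ed d) : ℂ :=
  (((2 * π) ^ (-(d : ℝ) / 2) : ℝ) : ℂ) *
    ∫ y : Ed d, f y * (starRingEnd ℂ) (φ (y - x)) * Complex.exp (-(Complex.I * (⟪y, ξ⟫ : ℝ)))

open FourierTransform Topology
open scoped SchwartzMap BoundedContinuousFunction

theorem LinearMap.exists_strongDual_comp_eq {S B : Type*} [AddCommGroup S] [Module ℂ S]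
    [NormedAddCommGroup B] [NormedSpace ℂ B] (Φ : S →ₗ[ℂ] B) (f : S →ₗ[ℂ] ℂ) {C : ℝ}
    (hbound : ∀ g, ‖f g‖ ≤ C * ‖Φ g‖) : ∃ ℓ : StrongDual ℂ B, ∀ g, ℓ (Φ g) = f g := by
  have hker : LinearMap.ker Φ ≤ LinearMap.ker f := fun g hg => by
    simpa [LinearMap.mem_ker.mp hg] using hbound g
  let ψ : LinearMap.range Φ →ₗ[ℂ] ℂ :=
    (LinearMap.ker Φ).liftQ f hker ∘ₗ Φ.quotKerEquivRange.symm.toLinearMap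
  have hψ (g : S) : ψ ⟨Φ g, g, rfl⟩ = f g := by
    have : Φ.quotKerEquivRange.symm ⟨Φ g, g, rfl⟩ = (LinearMap.ker Φ).mkQ g := by
      rw [LinearEquiv.symm_apply_eq]
      rfl
    simp [ψ, this]
  obtain ⟨ℓ, hℓ, -⟩ := exists_extension_norm_eq (LinearMap.range Φ)
    (ψ.mkContinuous C (by
      rintro ⟨_, g, rfl⟩
      exact (congrArg norm (hψ g)).le.trans (hbound g)))
  exact ⟨ℓ, fun g => (hℓ ⟨Φ g, g, rfl⟩).trans (hψ g)⟩

namespace SchwartzMap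

section Integral

variable {E F P : Type*} [NormedAddCommGroup E] [NormedSpace ℝ E] [NormedAddCommGroup F]
  [NormedSpace ℝ F]

theorem iteratedFDeriv_add (n : ℕ) (g h : 𝓢(E, F)) (t : E) :
    iteratedFDeriv ℝ n (g + h) t = iteratedFDeriv ℝ n g t + iteratedFDeriv ℝ n h t :=
  iteratedFDeriv_add_apply (g.smooth n).contDiffAt (h.smooth n).contDiffAt

theorem iteratedFDeriv_sub (n : ℕ) (g h : 𝓢(E, F)) (t : E) :
    iteratedFDeriv ℝ n (g - h) t = iteratedFDeriv ℝ n g t - iteratedFDeriv ℝ n h t :=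
  iteratedFDeriv_sub_apply (g.smooth n).contDiffAt (h.smooth n).contDiffAt

theorem continuous_iteratedFDeriv_apply (n : ℕ) (t : E) :
    Continuous fun g : 𝓢(E, F) => iteratedFDeriv ℝ n g t := by
  rw [continuous_iff_continuousAt]
  intro g
  rw [ContinuousAt, tendsto_iff_norm_sub_tendsto_zero]
  have h : Continuous fun h : 𝓢(E, F) => SchwartzMap.seminorm ℝ 0 n (h - g) :=
    ((schwartz_withSeminorms ℝ E F).continuous_seminorm (0, n)).comp (continuous_sub_right g)
  refine squeeze_zero (fun _ => norm_nonneg _) (fun h => ?_) (by simpa using h.tendsto g)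
  rw [← iteratedFDeriv_sub]
  exact norm_iteratedFDeriv_le_seminorm ℝ _ n t

variable [MeasurableSpace P] {μ : Measure P} [TopologicalSpace P] [OpensMeasurableSpace P]
  [SecondCountableTopology P]

theorem integrable_iteratedFDeriv_apply {G : P → 𝓢(E, F)} (hG : Continuous G) {n : ℕ}
    (hint : Integrable (fun p => SchwartzMap.seminorm ℝ 0 n (G p)) μ) (t : E) :
    Integrable (fun p => iteratedFDeriv ℝ n (G p) t) μ :=
  hint.mono' ((continuous_iteratedFDeriv_apply n t).comp hG).aestronglyMeasurable
    (.of_forall fun p => norm_iteratedFDeriv_le_seminorm ℝ (G p) n t)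

theorem iteratedFDeriv_eq_integral {G : P → 𝓢(E, F)} (hG : Continuous G)
    (hint : ∀ n, Integrable (fun p => SchwartzMap.seminorm ℝ 0 n (G p)) μ) {h : 𝓢(E, F)}
    (hh : ∀ t, h t = ∫ p, G p t ∂μ) (n : ℕ) (t : E) :
    iteratedFDeriv ℝ n h t = ∫ p, iteratedFDeriv ℝ n (G p) t ∂μ := by
  induction n generalizing t with
  | zero =>
    simp only [iteratedFDeriv_zero_eq_comp, Function.comp_apply, hh]
    exact ((continuousMultilinearCurryFin0 ℝ E
      F).symm.toContinuousLinearEquiv.integral_comp_comm _).symm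
  | succ n ih =>
    have hderiv (p : P) (s : E) : HasFDerivAt (fun s => iteratedFDeriv ℝ n (G p) s)
        (fderiv ℝ (iteratedFDeriv ℝ n (G p)) s) s :=
      (((G p).smooth (n + 1)).differentiable_iteratedFDeriv
        (by exact_mod_cast n.lt_succ_self) s).hasFDerivAt
    have key : HasFDerivAt (fun s => ∫ p, iteratedFDeriv ℝ n (G p) s ∂μ)
        (∫ p, fderiv ℝ (iteratedFDeriv ℝ n (G p)) t ∂μ) t := by
      refine hasFDerivAt_integral_of_dominated_of_fderiv_le
        (bound := fun p => SchwartzMap.seminorm ℝ 0 (n + 1) (G p)) (s := Set.univ)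
        (F' := fun s p => fderiv ℝ (iteratedFDeriv ℝ n (G p)) s)
        Filter.univ_mem
        (.of_forall fun s => (integrable_iteratedFDeriv_apply hG (hint n) s).1)
        (integrable_iteratedFDeriv_apply hG (hint n) t) ?_
        (.of_forall fun p s _ => ?_) (hint (n + 1)) (.of_forall fun p s _ => hderiv p s)
      · simp only [fderiv_iteratedFDeriv, Function.comp_apply]
        exact (LinearIsometryEquiv.continuous _).comp_aestronglyMeasurable
          (integrable_iteratedFDeriv_apply hG (hint (n + 1)) t).1
      · rw [norm_fderiv_iteratedFDeriv]
        exact norm_iteratedFDeriv_le_seminorm ℝ (G p) (n + 1) s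
    rw [iteratedFDeriv_succ_eq_comp_left, Function.comp_apply, funext ih, key.fderiv]
    simp only [iteratedFDeriv_succ_eq_comp_left, Function.comp_apply]
    have hcomm (L : (E →L[ℝ] E [×n]→L[ℝ] F) ≃L[ℝ] E [×(n + 1)]→L[ℝ] F)
        (g : P → E →L[ℝ] E [×n]→L[ℝ] F) : ∫ p, L (g p) ∂μ = L (∫ p, g p ∂μ) :=
      ContinuousLinearEquiv.integral_comp_comm (𝕜 := ℝ) (μ := μ) (E := E →L[ℝ] E [×n]→L[ℝ] F)
        (F := E [×(n + 1)]→L[ℝ] F) L g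
    exact (hcomm (continuousMultilinearCurryLeftEquiv ℝ
      (fun _ : Fin (n + 1) => E) F).symm.toContinuousLinearEquiv _).symm

end Integral

section Weighted

variable {E P : Type*} [NormedAddCommGroup E] [NormedSpace ℝ E]

/-- Families of bounded continuous functions with values in multilinear maps, indexed by a finite
set of Schwartz seminorms. -/
def WeightedDerivSpace (E : Type*) [NormedAddCommGroup E] [NormedSpace ℝ E]
    (s : Finset (ℕ × ℕ)) : Type _ :=
  ∀ i : s, E →ᵇ E [×i.1.2]→L[ℝ] ℂ

namespace WeightedDerivSpace

variable (s : Finset (ℕ × ℕ))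

noncomputable instance : NormedAddCommGroup (WeightedDerivSpace E s) :=
  inferInstanceAs (NormedAddCommGroup (∀ i : s, E →ᵇ E [×i.1.2]→L[ℝ] ℂ))

noncomputable instance : NormedSpace ℂ (WeightedDerivSpace E s) :=
  inferInstanceAs (NormedSpace ℂ (∀ i : s, E →ᵇ E [×i.1.2]→L[ℝ] ℂ))

instance : CompleteSpace (WeightedDerivSpace E s) :=
  inferInstanceAs (CompleteSpace (∀ i : s, E →ᵇ E [×i.1.2]→L[ℝ] ℂ))

variable {s}

theorem ext {a b : WeightedDerivSpace E s} (h : ∀ i t, a i t = b i t) : a = b :=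
  funext fun i => BoundedContinuousFunction.ext (h i)

theorem norm_le_iff {a : WeightedDerivSpace E s} {C : ℝ} (hC : 0 ≤ C) :
    ‖a‖ ≤ C ↔ ∀ i t, ‖a i t‖ ≤ C :=
  (pi_norm_le_iff_of_nonneg (x := (a : ∀ i : s, E →ᵇ E [×i.1.2]→L[ℝ] ℂ)) hC).trans
    (forall_congr' fun _ => BoundedContinuousFunction.norm_le hC)

/-- Evaluation of a component at a point. -/
noncomputable def evalCLM (i : s) (t : E) : WeightedDerivSpace E s →L[ℂ] E [×i.1.2]→L[ℝ] ℂ :=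
  LinearMap.mkContinuous
    { toFun := fun a => a i t
      map_add' := fun _ _ => rfl
      map_smul' := fun _ _ => rfl } 1
    fun a => by
      rw [one_mul]
      exact (norm_le_iff (norm_nonneg a)).1 le_rfl i t

theorem evalCLM_apply (i : s) (t : E) (a : WeightedDerivSpace E s) : evalCLM i t a = a i t := rfl

end WeightedDerivSpace

/-- The weighted derivatives `‖t‖ ^ k • D ^ n g(t)` of a Schwartz function, as bounded continuous
functions. -/
noncomputable def weightedDeriv (s : Finset (ℕ × ℕ)) (g : 𝓢(E, ℂ)) : WeightedDerivSpace E s :=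
  fun i => BoundedContinuousFunction.ofNormedAddCommGroup
    (fun t => ‖t‖ ^ i.1.1 • iteratedFDeriv ℝ i.1.2 g t)
    (by
      have := (g.smooth i.1.2).continuous_iteratedFDeriv le_rfl
      fun_prop)
    (SchwartzMap.seminorm ℝ i.1.1 i.1.2 g)
    (fun t => by
      rw [norm_smul, norm_pow, norm_norm]
      exact le_seminorm ℝ _ _ g t)

theorem weightedDeriv_apply (s : Finset (ℕ × ℕ)) (g : 𝓢(E, ℂ)) (i : s) (t : E) :
    weightedDeriv s g i t = ‖t‖ ^ i.1.1 • iteratedFDeriv ℝ i.1.2 g t := rfl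

theorem norm_weightedDeriv_apply (s : Finset (ℕ × ℕ)) (g : 𝓢(E, ℂ)) (i : s) (t : E) :
    ‖weightedDeriv s g i t‖ = ‖t‖ ^ i.1.1 * ‖iteratedFDeriv ℝ i.1.2 g t‖ := by
  rw [weightedDeriv_apply, norm_smul, norm_pow, norm_norm]

theorem norm_weightedDeriv_le (s : Finset (ℕ × ℕ)) (g : 𝓢(E, ℂ)) :
    ‖weightedDeriv s g‖ ≤ s.sup (schwartzSeminormFamily ℂ E ℂ) g := by
  refine (WeightedDerivSpace.norm_le_iff (by positivity)).2 fun i t => ?_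
  rw [norm_weightedDeriv_apply]
  exact (le_seminorm ℂ _ _ g t).trans
    (Seminorm.le_finset_sup_apply (p := schwartzSeminormFamily ℂ E ℂ) i.2)

theorem sup_seminorm_le_norm_weightedDeriv (s : Finset (ℕ × ℕ)) (g : 𝓢(E, ℂ)) :
    s.sup (schwartzSeminormFamily ℂ E ℂ) g ≤ ‖weightedDeriv s g‖ :=
  Seminorm.finset_sup_apply_le (norm_nonneg _) fun i hi =>
    seminorm_le_bound ℂ i.1 i.2 g (norm_nonneg _) fun t => by
      rw [← norm_weightedDeriv_apply s g ⟨i, hi⟩ t]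
      exact (WeightedDerivSpace.norm_le_iff (norm_nonneg _)).1 le_rfl _ _

theorem norm_weightedDeriv_le_sum (s : Finset (ℕ × ℕ)) (g : 𝓢(E, ℂ)) :
    ‖weightedDeriv s g‖ ≤ ∑ i ∈ s, SchwartzMap.seminorm ℝ i.1 i.2 g := by
  have h0 : ∀ i ∈ s, 0 ≤ SchwartzMap.seminorm ℝ i.1 i.2 g := fun i _ => apply_nonneg _ _
  refine (WeightedDerivSpace.norm_le_iff (Finset.sum_nonneg h0)).2 fun i t => ?_
  rw [norm_weightedDeriv_apply]
  exact (le_seminorm ℝ _ _ g t).trans (Finset.single_le_sum h0 i.2)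

/-- `weightedDeriv` as a continuous linear map. -/
noncomputable def weightedDerivCLM (s : Finset (ℕ × ℕ)) : 𝓢(E, ℂ) →L[ℂ] WeightedDerivSpace E s :=
  mkCLMtoNormedSpace (𝕜 := ℂ) (σ := RingHom.id ℂ) (weightedDeriv s)
    (fun g h => WeightedDerivSpace.ext fun i t => by
      change _ = weightedDeriv s g i t + weightedDeriv s h i t
      simp only [weightedDeriv_apply]
      exact (congrArg _ (iteratedFDeriv_add _ g h t)).trans (smul_add _ _ _))
    (fun c g => WeightedDerivSpace.ext fun i t => by
      change _ = c • weightedDeriv s g i t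
      rw [weightedDeriv_apply, weightedDeriv_apply, smul_comm c,
        ← iteratedFDeriv_const_smul_apply (g.smooth _).contDiffAt]
      rfl)
    ⟨s, 1, zero_le_one, fun g => by
      rw [one_mul]
      exact norm_weightedDeriv_le s g⟩

theorem weightedDerivCLM_apply (s : Finset (ℕ × ℕ)) (g : 𝓢(E, ℂ)) :
    weightedDerivCLM s g = weightedDeriv s g := rfl

/-- A tempered distribution factors through finitely many weighted derivatives. -/
theorem exists_factor_weightedDerivCLM (f : 𝓢(E, ℂ) →L[ℂ] ℂ) :
    ∃ (s : Finset (ℕ × ℕ)) (ℓ : StrongDual ℂ (WeightedDerivSpace E s)),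
      ∀ g, ℓ (weightedDerivCLM s g) = f g := by
  obtain ⟨s, C, -, hC⟩ := Seminorm.bound_of_continuous (schwartz_withSeminorms ℂ E ℂ)
    ((normSeminorm ℂ ℂ).comp f.toLinearMap) (continuous_norm.comp f.continuous)
  refine ⟨s, LinearMap.exists_strongDual_comp_eq (weightedDerivCLM s).toLinearMap f.toLinearMap
    (C := C) fun g => (hC g).trans ?_⟩
  rw [smul_apply, NNReal.smul_def, smul_eq_mul]
  gcongr
  exact sup_seminorm_le_norm_weightedDeriv s g

variable [MeasurableSpace P] {μ : Measure P} [TopologicalSpace P] [OpensMeasurableSpace P]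
  [SecondCountableTopology P]

/-- A tempered distribution commutes with absolutely convergent integrals of Schwartz functions. -/
theorem integrable_and_integral_eq (f : 𝓢(E, ℂ) →L[ℂ] ℂ) {G : P → 𝓢(E, ℂ)}
    (hG : Continuous G) (hint : ∀ k n, Integrable (fun p => SchwartzMap.seminorm ℝ k n (G p)) μ)
    {h : 𝓢(E, ℂ)} (hh : ∀ t, h t = ∫ p, G p t ∂μ) :
    Integrable (fun p => f (G p)) μ ∧ ∫ p, f (G p) ∂μ = f h := by
  obtain ⟨s, ℓ, hℓ⟩ := exists_factor_weightedDerivCLM f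
  have hΦ : Integrable (fun p => weightedDerivCLM s (G p)) μ := by
    exact Integrable.mono' (integrable_finsetSum s fun i _ => hint i.1 i.2)
      ((weightedDerivCLM s).continuous.comp hG).aestronglyMeasurable
      (.of_forall fun p => norm_weightedDeriv_le_sum s (G p))
  have hint_eq : ∫ p, weightedDerivCLM s (G p) ∂μ = weightedDerivCLM s h := by
    refine WeightedDerivSpace.ext fun i t => ?_
    have h1 := (WeightedDerivSpace.evalCLM i t).integral_comp_comm hΦ
    have h2 (g : 𝓢(E, ℂ)) : WeightedDerivSpace.evalCLM i t (weightedDerivCLM s g) =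
      ‖t‖ ^ i.1.1 • iteratedFDeriv ℝ i.1.2 g t := rfl
    rw [← WeightedDerivSpace.evalCLM_apply, ← WeightedDerivSpace.evalCLM_apply, ← h1, h2]
    simp only [h2]
    rw [integral_smul, iteratedFDeriv_eq_integral hG (hint 0) hh]
  have h3 := ℓ.integral_comp_comm hΦ
  have h4 := ℓ.integrable_comp hΦ
  simp only [hℓ] at h3 h4
  rw [hint_eq, hℓ] at h3
  exact ⟨h4, h3⟩

end Weighted

end SchwartzMap

section Parametric

variable {E F P : Type*} [NormedAddCommGroup E] [NormedSpace ℝ E] [NormedAddCommGroup F]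
  [NormedSpace ℝ F]

theorem SchwartzMap.continuous_of_iteratedFDeriv [ProperSpace E] [TopologicalSpace P]
    {G : P → 𝓢(E, F)}
    (hG : ∀ n, Continuous fun q : P × E => iteratedFDeriv ℝ n (G q.1) q.2)
    (hb : ∀ k n p₀, ∃ C, ∀ᶠ p in 𝓝 p₀, SchwartzMap.seminorm ℝ k n (G p) ≤ C) :
    Continuous G := by
  rw [continuous_iff_continuousAt]
  intro p₀
  rw [ContinuousAt, (schwartz_withSeminorms ℝ E F).tendsto_nhds]
  rintro ⟨k, n⟩ ε hε
  obtain ⟨C, hC⟩ := hb (k + 1) n p₀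
  have hC₀ : 0 ≤ C := (apply_nonneg _ _).trans hC.self_of_nhds
  set R : ℝ := 4 * C / ε + 1
  have hR : 0 < R := by positivity
  have hδ : 0 < ε / (2 * R ^ k) := by positivity
  obtain ⟨v, hv, hvK⟩ := (isCompact_closedBall (0 : E) R).mem_uniformity_of_prod
    (f := fun p t => iteratedFDeriv ℝ n (G p) t) (s := Set.univ) (q := p₀)
    (hG n).continuousOn (Set.mem_univ _) (Metric.dist_mem_uniformity hδ)
  rw [nhdsWithin_univ] at hv
  filter_upwards [hC, hv] with p hp hpv
  refine lt_of_le_of_lt (SchwartzMap.seminorm_le_bound ℝ k n _ (half_pos hε).le fun t => ?_)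
    (half_lt_self hε)
  rw [SchwartzMap.iteratedFDeriv_sub]
  rcases le_or_gt ‖t‖ R with ht | ht
  · have h1 : ‖iteratedFDeriv ℝ n (G p) t - iteratedFDeriv ℝ n (G p₀) t‖ ≤ ε / (2 * R ^ k) := by
      rw [← dist_eq_norm]
      exact le_of_lt (hvK p hpv t (by simpa using ht))
    calc ‖t‖ ^ k * ‖iteratedFDeriv ℝ n (G p) t - iteratedFDeriv ℝ n (G p₀) t‖
        ≤ R ^ k * (ε / (2 * R ^ k)) := by gcongr
      _ = ε / 2 := by field_simp
  · have h2 (q : P) (hq : SchwartzMap.seminorm ℝ (k + 1) n (G q) ≤ C) :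
        R * (‖t‖ ^ k * ‖iteratedFDeriv ℝ n (G q) t‖) ≤ C :=
      calc R * (‖t‖ ^ k * ‖iteratedFDeriv ℝ n (G q) t‖)
          ≤ ‖t‖ * (‖t‖ ^ k * ‖iteratedFDeriv ℝ n (G q) t‖) := by gcongr
        _ = ‖t‖ ^ (k + 1) * ‖iteratedFDeriv ℝ n (G q) t‖ := by ring
        _ ≤ C := (SchwartzMap.le_seminorm ℝ _ _ _ t).trans hq
    have h3 : R * (ε / 2) = 2 * C + ε / 2 := by
      simp only [R]
      field_simp
      ring
    refine le_of_mul_le_mul_left ?_ hR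
    calc R * (‖t‖ ^ k * ‖iteratedFDeriv ℝ n (G p) t - iteratedFDeriv ℝ n (G p₀) t‖)
        ≤ R * (‖t‖ ^ k * (‖iteratedFDeriv ℝ n (G p) t‖ + ‖iteratedFDeriv ℝ n (G p₀) t‖)) := by
          gcongr
          exact norm_sub_le _ _
      _ = R * (‖t‖ ^ k * ‖iteratedFDeriv ℝ n (G p) t‖)
          + R * (‖t‖ ^ k * ‖iteratedFDeriv ℝ n (G p₀) t‖) := by ring
      _ ≤ C + C := add_le_add (h2 p hp) (h2 p₀ hC.self_of_nhds)
      _ ≤ R * (ε / 2) := by linarith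

theorem continuous_iteratedFDeriv_right [NormedAddCommGroup P] [NormedSpace ℝ P] {n : ℕ}
    {A : P × E → F} (hA : ContDiff ℝ n A) :
    Continuous fun q : P × E => iteratedFDeriv ℝ n (fun t => A (q.1, t)) q.2 := by
  have h (q : P × E) : iteratedFDeriv ℝ n (fun t => A (q.1, t)) q.2 =
      (iteratedFDeriv ℝ n A q).compContinuousLinearMap
        fun _ => ContinuousLinearMap.inr ℝ P E := by
    have h1 : (fun t => A (q.1, t)) =
        (fun z => A ((q.1, 0) + z)) ∘ ContinuousLinearMap.inr ℝ P E := by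
      ext t
      simp
    have h2 : ContDiff ℝ n (fun z => A ((q.1, 0) + z)) := hA.comp (contDiff_const.add contDiff_id)
    rw [h1, (ContinuousLinearMap.inr ℝ P E).iteratedFDeriv_comp_right h2 q.2 le_rfl,
      iteratedFDeriv_comp_add_left]
    simp
  simp only [h]
  exact (ContinuousMultilinearMap.compContinuousLinearMapL (𝕜 := ℝ) (F := F)
    fun _ : Fin n => ContinuousLinearMap.inr ℝ P E).continuous.comp
      (hA.continuous_iteratedFDeriv le_rfl)

theorem norm_iteratedFDeriv_mul_le_of_le {A : Type*} [NormedRing A] [NormedAlgebra ℝ A]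
    {g h : E → A} {n : ℕ} (hg : ContDiff ℝ n g) (hh : ContDiff ℝ n h) {t : E} {a b : ℝ}
    (ha : ∀ i ≤ n, ‖iteratedFDeriv ℝ i g t‖ ≤ a) (hb : ∀ i ≤ n, ‖iteratedFDeriv ℝ i h t‖ ≤ b) :
    ‖iteratedFDeriv ℝ n (fun t => g t * h t) t‖ ≤ 2 ^ n * (a * b) := by
  refine (norm_iteratedFDeriv_mul_le hg hh t le_rfl).trans ?_
  have ha₀ : 0 ≤ a := (norm_nonneg _).trans (ha 0 n.zero_le)
  calc ∑ i ∈ Finset.range (n + 1),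
        (n.choose i : ℝ) * ‖iteratedFDeriv ℝ i g t‖ * ‖iteratedFDeriv ℝ (n - i) h t‖
      ≤ ∑ i ∈ Finset.range (n + 1), (n.choose i : ℝ) * (a * b) := by
        refine Finset.sum_le_sum fun i hi => ?_
        rw [mul_assoc]
        gcongr
        · exact ha i (Finset.mem_range_succ_iff.1 hi)
        · exact hb _ (n.sub_le i)
    _ = 2 ^ n * (a * b) := by
        rw [← Finset.sum_mul]
        exact_mod_cast congrArg (· * (a * b)) (congrArg (Nat.cast (R := ℝ)) (Nat.sum_range_choose n))

end Parametric

theorem SchwartzMap.exists_one_add_pow_mul_le {E F : Type*} [NormedAddCommGroup E]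
    [NormedSpace ℝ E] [NormedAddCommGroup F] [NormedSpace ℝ F] (ψ : 𝓢(E, F)) (k n : ℕ) :
    ∃ M, 0 ≤ M ∧ ∀ i ≤ n, ∀ s, ‖iteratedFDeriv ℝ i ψ s‖ ≤ M / (1 + ‖s‖) ^ k :=
  ⟨_, by positivity, fun i hi s => (le_div_iff₀' (by positivity)).2
    (one_add_le_sup_seminorm_apply (𝕜 := ℝ) (m := (k, n)) le_rfl hi ψ s)⟩

section TimeFrequencyShift

variable {E : Type*} [NormedAddCommGroup E] [InnerProductSpace ℝ E]

theorem one_add_norm_add_le {E : Type*} [SeminormedAddCommGroup E] (x y : E) :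
    1 + ‖x + y‖ ≤ (1 + ‖x‖) * (1 + ‖y‖) := by
  nlinarith [norm_add_le x y, norm_nonneg x, norm_nonneg y,
    mul_nonneg (norm_nonneg x) (norm_nonneg y)]

theorem one_add_norm_sub_le {E : Type*} [SeminormedAddCommGroup E] (x y : E) :
    1 + ‖x - y‖ ≤ (1 + ‖x‖) * (1 + ‖y‖) := by
  simpa [sub_eq_add_neg] using one_add_norm_add_le x (-y)

theorem contDiff_cexp_inner : ContDiff ℝ ⊤
    fun q : E × E => cexp (-(I * (⟪q.1, q.2⟫ : ℝ))) := by
  have h : ContDiff ℝ ⊤ fun q : E × E => ((⟪q.1, q.2⟫ : ℝ) : ℂ) :=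
    ofRealCLM.contDiff.comp (contDiff_fst.inner ℝ contDiff_snd)
  exact (contDiff_const.mul h).neg.cexp

theorem norm_cexp_inner (t ξ : E) : ‖cexp (-(I * (⟪t, ξ⟫ : ℝ)))‖ = 1 := by
  rw [norm_exp]
  simp

theorem norm_iteratedFDeriv_cexp_inner_le (n : ℕ) (t ξ : E) :
    ‖iteratedFDeriv ℝ n (fun t : E => cexp (-(I * (⟪t, ξ⟫ : ℝ)))) t‖ ≤ ‖ξ‖ ^ n := by
  have h (r : ℝ) : ‖iteratedFDeriv ℝ n (fun r : ℝ => cexp (-I * r)) r‖ ≤ 1 := by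
    rw [norm_iteratedFDeriv_eq_norm_iteratedDeriv]
    have h1 : iteratedDeriv n (fun r : ℝ => cexp (-I * r)) =
        fun r : ℝ => (-I) ^ n * cexp (-I * r) := by
      induction n with
      | zero => simp
      | succ n ih =>
        rw [iteratedDeriv_succ, ih]
        ext r
        have : HasDerivAt (fun r : ℝ => cexp (-I * r)) (cexp (-I * r) * (-I * 1)) r :=
          ((ofRealCLM.hasDerivAt (x := r)).const_mul (-I)).cexp
        rw [(this.const_mul _).deriv]
        ring
    rw [h1]
    simp [norm_exp]
  have h2 : (fun t : E => cexp (-(I * (⟪t, ξ⟫ : ℝ)))) =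
      (fun r : ℝ => cexp (-I * r)) ∘ innerSL ℝ ξ := by
    ext t
    simp [real_inner_comm]
  have h3 : ContDiff ℝ n fun r : ℝ => cexp (-I * r) :=
    (contDiff_const.mul ofRealCLM.contDiff).cexp
  rw [h2, (innerSL ℝ ξ).iteratedFDeriv_comp_right h3 t le_rfl]
  refine (ContinuousMultilinearMap.norm_compContinuousLinearMap_le _ _).trans ?_
  rw [Finset.prod_const, Finset.card_univ, Fintype.card_fin, innerSL_apply_norm]
  exact mul_le_of_le_one_left (by positivity) (h _)

/-- Schwartz seminorms of time-frequency shifts grow polynomially in the shift. -/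
theorem SchwartzMap.exists_seminorm_timeFrequencyShift_le (ψ : 𝓢(E, ℂ)) (k n : ℕ) :
    ∃ C, 0 ≤ C ∧ ∀ (x ξ : E) (g : 𝓢(E, ℂ)),
      (∀ t, g t = ψ (t - x) * cexp (-(I * (⟪t, ξ⟫ : ℝ)))) →
      SchwartzMap.seminorm ℝ k n g ≤ C * ((1 + ‖x‖) ^ k * (1 + ‖ξ‖) ^ n) := by
  obtain ⟨M, hM, h⟩ := ψ.exists_one_add_pow_mul_le k n
  refine ⟨2 ^ n * M, by positivity, fun x ξ g hg => ?_⟩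
  refine seminorm_le_bound ℝ k n g (by positivity) fun t => ?_
  have h1 : ‖iteratedFDeriv ℝ n g t‖ ≤ 2 ^ n * (M / (1 + ‖t - x‖) ^ k * (1 + ‖ξ‖) ^ n) := by
    rw [show ⇑g = _ from funext hg]
    refine norm_iteratedFDeriv_mul_le_of_le
      ((ψ.smooth n).comp (contDiff_id.sub contDiff_const))
      ((contDiff_cexp_inner.comp (contDiff_id.prodMk contDiff_const)).of_le le_top)
      (fun i hi => ?_) (fun i hi => ?_)
    · change ‖iteratedFDeriv ℝ i (fun t => ψ (t - x)) t‖ ≤ _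
      rw [iteratedFDeriv_comp_sub]
      exact h i hi _
    · refine (norm_iteratedFDeriv_cexp_inner_le i t ξ).trans ?_
      calc ‖ξ‖ ^ i ≤ (1 + ‖ξ‖) ^ i := by gcongr; simp
        _ ≤ (1 + ‖ξ‖) ^ n := by gcongr; simp
  have h2 : ‖t‖ ^ k ≤ (1 + ‖t - x‖) ^ k * (1 + ‖x‖) ^ k := by
    rw [← mul_pow]
    gcongr
    have := one_add_norm_add_le (t - x) x
    rw [sub_add_cancel] at this
    linarith
  calc ‖t‖ ^ k * ‖iteratedFDeriv ℝ n g t‖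
      ≤ ((1 + ‖t - x‖) ^ k * (1 + ‖x‖) ^ k)
        * (2 ^ n * (M / (1 + ‖t - x‖) ^ k * (1 + ‖ξ‖) ^ n)) := by gcongr
    _ = 2 ^ n * M * ((1 + ‖x‖) ^ k * (1 + ‖ξ‖) ^ n) := by field_simp

theorem SchwartzMap.exists_seminorm_mul_translate_le (φ ψ : 𝓢(E, ℂ)) (a k n : ℕ) :
    ∃ C, 0 ≤ C ∧ ∀ (y : E) (g : 𝓢(E, ℂ)), (∀ t, g t = φ t * ψ (t - y)) →
      SchwartzMap.seminorm ℝ k n g ≤ C / (1 + ‖y‖) ^ a := by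
  obtain ⟨M, hM, h⟩ := φ.exists_one_add_pow_mul_le (a + k) n
  obtain ⟨N, hN, h'⟩ := ψ.exists_one_add_pow_mul_le a n
  refine ⟨2 ^ n * (M * N), by positivity, fun y g hg => ?_⟩
  refine seminorm_le_bound ℝ k n g (by positivity) fun t => ?_
  have h1 : ‖iteratedFDeriv ℝ n g t‖ ≤
      2 ^ n * (M / (1 + ‖t‖) ^ (a + k) * (N / (1 + ‖t - y‖) ^ a)) := by
    rw [show ⇑g = _ from funext hg]
    refine norm_iteratedFDeriv_mul_le_of_le (φ.smooth n)
      ((ψ.smooth n).comp (contDiff_id.sub contDiff_const))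
      (fun i hi => h i hi t) (fun i hi => ?_)
    change ‖iteratedFDeriv ℝ i (fun t => ψ (t - y)) t‖ ≤ _
    rw [iteratedFDeriv_comp_sub]
    exact h' i hi _
  have h2 : (1 + ‖y‖) ^ a ≤ (1 + ‖t‖) ^ a * (1 + ‖t - y‖) ^ a := by
    rw [← mul_pow]
    gcongr
    simpa using one_add_norm_sub_le t (t - y)
  have h3 : ‖t‖ ^ k ≤ (1 + ‖t‖) ^ k := by gcongr; simp
  rw [le_div_iff₀ (by positivity)]
  calc ‖t‖ ^ k * ‖iteratedFDeriv ℝ n g t‖ * (1 + ‖y‖) ^ a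
      ≤ (1 + ‖t‖) ^ k * (2 ^ n * (M / (1 + ‖t‖) ^ (a + k) * (N / (1 + ‖t - y‖) ^ a)))
        * ((1 + ‖t‖) ^ a * (1 + ‖t - y‖) ^ a) := by gcongr
    _ = 2 ^ n * (M * N) := by rw [pow_add]; field_simp

end TimeFrequencyShift

namespace SchwartzMap

section TimeFrequencyShift

variable {E : Type*} [NormedAddCommGroup E] [InnerProductSpace ℝ E]

theorem continuous_timeFrequencyShift [ProperSpace E] (ψ : 𝓢(E, ℂ)) {w : E → E → 𝓢(E, ℂ)}
    (hw : ∀ x ξ t, w x ξ t = ψ (t - x) * cexp (-(I * (⟪t, ξ⟫ : ℝ)))) :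
    Continuous fun q : E × E => w q.1 q.2 := by
  refine continuous_of_iteratedFDeriv (fun n => ?_) fun k n q₀ => ?_
  · have hA : ContDiff ℝ n fun z : (E × E) × E =>
        ψ (z.2 - z.1.1) * cexp (-(I * (⟪z.2, z.1.2⟫ : ℝ))) :=
      ((ψ.smooth n).comp (contDiff_snd.sub contDiff_fst.fst)).mul
        ((contDiff_cexp_inner.of_le le_top).comp (contDiff_snd.prodMk contDiff_fst.snd))
    refine (continuous_iteratedFDeriv_right hA).congr fun q => ?_
    rw [← show ⇑(w q.1.1 q.1.2) = _ from funext (hw q.1.1 q.1.2)]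
  · obtain ⟨C, -, hC⟩ := ψ.exists_seminorm_timeFrequencyShift_le k n
    have hcont : Continuous fun q : E × E => C * ((1 + ‖q.1‖) ^ k * (1 + ‖q.2‖) ^ n) := by fun_prop
    refine ⟨C * ((1 + ‖q₀.1‖) ^ k * (1 + ‖q₀.2‖) ^ n) + 1, ?_⟩
    filter_upwards [hcont.continuousAt.eventually_le_const (lt_add_one _)] with q hq
    exact (hC q.1 q.2 _ (hw q.1 q.2)).trans hq

theorem exists_one_add_pow_mul_norm_apply_le {E F E₂ F₂ : Type*} [NormedAddCommGroup E]
    [NormedSpace ℝ E] [NormedAddCommGroup F] [NormedSpace ℝ F] [NormedAddCommGroup E₂]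
    [NormedSpace ℝ E₂] [NormedAddCommGroup F₂] [NormedSpace ℝ F₂] (L : 𝓢(E, F) →L[ℝ] 𝓢(E₂, F₂))
    (b : ℕ) : ∃ (s : Finset (ℕ × ℕ)) (C : ℝ), 0 ≤ C ∧ ∀ g t,
      (1 + ‖t‖) ^ b * ‖L g t‖ ≤ C * ∑ i ∈ s, SchwartzMap.seminorm ℝ i.1 i.2 g := by
  let q : Seminorm ℝ 𝓢(E₂, F₂) := (Finset.Iic (b, 0)).sup (schwartzSeminormFamily ℝ E₂ F₂)
  have hq : Continuous q := Seminorm.continuous_finsetSup fun i _ =>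
    (schwartz_withSeminorms ℝ E₂ F₂).continuous_seminorm i
  obtain ⟨s, C, -, hC⟩ := Seminorm.bound_of_continuous (schwartz_withSeminorms ℝ E F)
    (q.comp L.toLinearMap) (hq.comp L.continuous)
  refine ⟨s, 2 ^ b * C, by positivity, fun g t => ?_⟩
  have h1 := one_add_le_sup_seminorm_apply (𝕜 := ℝ) (m := (b, 0)) le_rfl le_rfl (L g) t
  rw [norm_iteratedFDeriv_zero] at h1
  have h2 : s.sup (schwartzSeminormFamily ℝ E F) g ≤
      ∑ i ∈ s, SchwartzMap.seminorm ℝ i.1 i.2 g := by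
    have h0 : ∀ i ∈ s, 0 ≤ SchwartzMap.seminorm ℝ i.1 i.2 g := fun i _ => apply_nonneg _ _
    refine Seminorm.finset_sup_apply_le (Finset.sum_nonneg h0) fun i hi => ?_
    rw [schwartzSeminormFamily_apply]
    exact Finset.single_le_sum h0 hi
  have h3 := hC g
  rw [smul_apply, NNReal.smul_def, smul_eq_mul] at h3
  rw [mul_assoc]
  refine h1.trans ?_
  gcongr
  refine h3.trans ?_
  gcongr

end TimeFrequencyShift

section Gabor

variable {E : Type*} [NormedAddCommGroup E] [InnerProductSpace ℝ E]

/-- The product of a Schwartz function with a translate of another one. -/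
noncomputable def mulTranslate (φ ψ : 𝓢(E, ℂ)) (y : E) : 𝓢(E, ℂ) :=
  pairing (ContinuousLinearMap.mul ℂ ℂ) φ (compSubConstCLM ℂ y ψ)

theorem mulTranslate_apply (φ ψ : 𝓢(E, ℂ)) (y s : E) :
    mulTranslate φ ψ y s = φ s * ψ (s - y) := rfl

variable [FiniteDimensional ℝ E] [MeasurableSpace E] [BorelSpace E]

/-- The unnormalized short-time Fourier transform of `φ` with respect to the window whose complex
conjugate is `ψ`. -/
noncomputable def windowedFourier (φ ψ : 𝓢(E, ℂ)) (y η : E) : ℂ :=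
  ∫ s, φ s * ψ (s - y) * cexp (-(I * (⟪s, η⟫ : ℝ)))

theorem windowedFourier_eq_fourier (φ ψ : 𝓢(E, ℂ)) (y η : E) :
    windowedFourier φ ψ y η = 𝓕 (mulTranslate φ ψ y) ((2 * π)⁻¹ • η) := by
  rw [fourier_coe, Real.fourier_eq', windowedFourier]
  refine integral_congr_ae (.of_forall fun s => ?_)
  simp only [mulTranslate_apply, smul_eq_mul]
  rw [mul_comm]
  congr 2
  rw [inner_smul_right]
  have : -2 * π * ((2 * π)⁻¹ * ⟪s, η⟫) = -⟪s, η⟫ := by field_simp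
  rw [this]
  push_cast
  ring

theorem exists_norm_windowedFourier_le (φ ψ : 𝓢(E, ℂ)) (a b : ℕ) :
    ∃ C, 0 ≤ C ∧ ∀ y η, ‖windowedFourier φ ψ y η‖ ≤ C / ((1 + ‖y‖) ^ a * (1 + ‖η‖) ^ b) := by
  obtain ⟨s, C, hC, h⟩ := exists_one_add_pow_mul_norm_apply_le
    (fourierCLM ℝ 𝓢(E, ℂ) (F := 𝓢(E, ℂ))) b
  choose M hM hM' using fun i : ℕ × ℕ => φ.exists_seminorm_mul_translate_le ψ a i.1 i.2
  have h2π : 1 ≤ 2 * π := by linarith [pi_gt_three]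
  refine ⟨(2 * π) ^ b * (C * ∑ i ∈ s, M i), by
    have := Finset.sum_nonneg fun i (_ : i ∈ s) => hM i
    positivity, fun y η => ?_⟩
  have h1 := h (mulTranslate φ ψ y) ((2 * π)⁻¹ • η)
  rw [fourierCLM_apply, ← windowedFourier_eq_fourier] at h1
  have h2 : ∑ i ∈ s, SchwartzMap.seminorm ℝ i.1 i.2 (mulTranslate φ ψ y) ≤
      (∑ i ∈ s, M i) / (1 + ‖y‖) ^ a := by
    rw [Finset.sum_div]
    exact Finset.sum_le_sum fun i _ => hM' i y _ (mulTranslate_apply φ ψ y)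
  have h3 : 1 + ‖η‖ ≤ 2 * π * (1 + ‖(2 * π)⁻¹ • η‖) := by
    rw [norm_smul, norm_inv, Real.norm_of_nonneg (by positivity : 0 ≤ 2 * π), mul_add, mul_one,
      mul_inv_cancel_left₀ (by positivity)]
    linarith
  rw [le_div_iff₀ (by positivity)]
  calc ‖windowedFourier φ ψ y η‖ * ((1 + ‖y‖) ^ a * (1 + ‖η‖) ^ b)
      ≤ ‖windowedFourier φ ψ y η‖ *
        ((1 + ‖y‖) ^ a * (2 * π * (1 + ‖(2 * π)⁻¹ • η‖)) ^ b) := by gcongr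
    _ = (2 * π) ^ b * (1 + ‖y‖) ^ a *
        ((1 + ‖(2 * π)⁻¹ • η‖) ^ b * ‖windowedFourier φ ψ y η‖) := by
          rw [mul_pow]
          ring
    _ ≤ (2 * π) ^ b * (1 + ‖y‖) ^ a * (C * ((∑ i ∈ s, M i) / (1 + ‖y‖) ^ a)) := by
          exact mul_le_mul_of_nonneg_left (h1.trans (mul_le_mul_of_nonneg_left h2 hC))
            (by positivity)
    _ = (2 * π) ^ b * (C * ∑ i ∈ s, M i) := by field_simp

theorem continuous_windowedFourier (φ ψ : 𝓢(E, ℂ)) :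
    Continuous fun q : E × E => windowedFourier φ ψ q.1 q.2 := by
  have hc : Continuous fun z : E × E => cexp (-(I * (⟪z.1, z.2⟫ : ℝ))) :=
    contDiff_cexp_inner.continuous
  refine continuous_of_dominated
    (bound := fun s => ‖φ s‖ * SchwartzMap.seminorm ℝ 0 0 ψ) (fun q => ?_)
    (fun q => .of_forall fun s => ?_) (φ.integrable.norm.mul_const _) (.of_forall fun s => ?_)
  · exact ((φ.continuous.mul (ψ.continuous.comp (continuous_id.sub continuous_const))).mul
      (hc.comp (continuous_id.prodMk continuous_const))).aestronglyMeasurable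
  · rw [norm_mul, norm_cexp_inner, mul_one, norm_mul]
    gcongr
    exact norm_le_seminorm ℝ ψ _
  · exact (continuous_const.mul (ψ.continuous.comp (continuous_const.sub continuous_fst))).mul
      (hc.comp (continuous_const.prodMk continuous_snd))

theorem integrable_windowedFourier_mul (φ ψ : 𝓢(E, ℂ)) (k n : ℕ) :
    Integrable fun q : E × E =>
      (1 + ‖q.1‖) ^ k * (1 + ‖q.2‖) ^ n * ‖windowedFourier φ ψ q.1 q.2‖ := by
  set N := Module.finrank ℝ E + 1 with hN
  obtain ⟨C, hC, h⟩ := exists_norm_windowedFourier_le φ ψ (N + k) (N + n)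
  have hint : Integrable fun y : E => (1 + ‖y‖) ^ (-(N : ℝ)) :=
    integrable_one_add_norm (by rw [hN]; exact_mod_cast Nat.lt_succ_self _)
  have hcont := (continuous_windowedFourier φ ψ).norm
  refine ((hint.mul_prod hint).const_mul C).mono' ?_ (.of_forall fun q => ?_)
  · exact Continuous.aestronglyMeasurable (by fun_prop)
  · rw [Real.norm_of_nonneg (by positivity), rpow_neg (by positivity), rpow_neg (by positivity),
      rpow_natCast, rpow_natCast]
    calc (1 + ‖q.1‖) ^ k * (1 + ‖q.2‖) ^ n * ‖windowedFourier φ ψ q.1 q.2‖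
        ≤ (1 + ‖q.1‖) ^ k * (1 + ‖q.2‖) ^ n *
          (C / ((1 + ‖q.1‖) ^ (N + k) * (1 + ‖q.2‖) ^ (N + n))) := by
            gcongr
            exact h q.1 q.2
      _ = C * (((1 + ‖q.1‖) ^ N)⁻¹ * ((1 + ‖q.2‖) ^ N)⁻¹) := by
            rw [pow_add, pow_add]
            field_simp
            ring

theorem integral_cexp_mul_windowedFourier (φ ψ : 𝓢(E, ℂ)) (y v : E) :
    ∫ η, cexp (I * (⟪v, η⟫ : ℝ)) * windowedFourier φ ψ y η =
      ((2 * π) ^ Module.finrank ℝ E : ℝ) * (φ v * ψ (v - y)) := by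
  have h1 := DFunLike.congr_fun
    (FourierPair.fourierInv_fourier_eq (F := 𝓢(E, ℂ)) (mulTranslate φ ψ y)) v
  rw [fourierInv_coe, Real.fourierInv_eq', mulTranslate_apply] at h1
  have h2 := Measure.integral_comp_smul volume (fun w : E =>
    cexp (↑(2 * π * ⟪w, v⟫) * I) • 𝓕 (mulTranslate φ ψ y) w) (2 * π)⁻¹
  rw [h1, inv_pow, inv_inv, abs_of_pos (by positivity), real_smul] at h2
  rw [← h2]
  refine integral_congr_ae (.of_forall fun η => ?_)
  simp only [smul_eq_mul]
  rw [← windowedFourier_eq_fourier, inner_smul_left, real_inner_comm v η]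
  congr 2
  have : 2 * π * ((starRingEnd ℝ) (2 * π)⁻¹ * ⟪v, η⟫) = ⟪v, η⟫ := by
    simp only [conj_trivial]
    field_simp
  rw [this, mul_comm]

end Gabor

end SchwartzMap

namespace SchwartzMap

section TwistedConvolution

variable {E : Type*} [NormedAddCommGroup E] [InnerProductSpace ℝ E] [FiniteDimensional ℝ E]
  [MeasurableSpace E] [BorelSpace E]

theorem integrable_seminorm_timeFrequencyShift {φ ψ ψ' : 𝓢(E, ℂ)} {w : E → E → 𝓢(E, ℂ)}
    (hw : ∀ x ξ t, w x ξ t = ψ (t - x) * cexp (-(I * (⟪t, ξ⟫ : ℝ)))) (x ξ : E) (k n : ℕ)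
    {G : E × E → 𝓢(E, ℂ)} (hG : Continuous G)
    (hGw : ∀ p, ∃ c : ℂ, ‖c‖ = ‖windowedFourier φ ψ' p.1 p.2‖ ∧ G p = c • w (x - p.1) (ξ - p.2)) :
    Integrable fun p => SchwartzMap.seminorm ℝ k n (G p) := by
  obtain ⟨C, hC, h⟩ := ψ.exists_seminorm_timeFrequencyShift_le k n
  refine ((integrable_windowedFourier_mul φ ψ' k n).const_mul
    (C * ((1 + ‖x‖) ^ k * (1 + ‖ξ‖) ^ n))).mono'
    (((schwartz_withSeminorms ℝ E ℂ).continuous_seminorm (k, n)).comp hG).aestronglyMeasurable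
    (.of_forall fun p => ?_)
  obtain ⟨c, hc, hGc⟩ := hGw p
  have h1 : SchwartzMap.seminorm ℝ k n (G p) =
      ‖c‖ * SchwartzMap.seminorm ℝ k n (w (x - p.1) (ξ - p.2)) := by
    rw [hGc]
    exact map_smul_eq_mul (SchwartzMap.seminorm ℂ k n) c _
  rw [Real.norm_of_nonneg (apply_nonneg _ _), h1, hc]
  calc ‖windowedFourier φ ψ' p.1 p.2‖ * SchwartzMap.seminorm ℝ k n (w (x - p.1) (ξ - p.2))
      ≤ ‖windowedFourier φ ψ' p.1 p.2‖ * (C * (((1 + ‖x‖) * (1 + ‖p.1‖)) ^ k *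
          ((1 + ‖ξ‖) * (1 + ‖p.2‖)) ^ n)) := by
        gcongr
        refine (h _ _ _ (hw _ _)).trans ?_
        gcongr
        · exact one_add_norm_sub_le _ _
        · exact one_add_norm_sub_le _ _
    _ = C * ((1 + ‖x‖) ^ k * (1 + ‖ξ‖) ^ n) *
        ((1 + ‖p.1‖) ^ k * (1 + ‖p.2‖) ^ n * ‖windowedFourier φ ψ' p.1 p.2‖) := by
        rw [mul_pow, mul_pow]
        ring

/-- Twisted convolution of short-time Fourier transforms, evaluated on the level of windows. -/
theorem integral_timeFrequencyShift_twisted (φ ψ₁ ψ₂ : 𝓢(E, ℂ)) (x ξ t : E)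
    (hint : Integrable fun p : E × E => windowedFourier φ ψ₂ p.1 p.2 *
      cexp (-(I * (⟪x - p.1, p.2⟫ : ℝ))) *
        (ψ₁ (t - (x - p.1)) * cexp (-(I * (⟪t, ξ - p.2⟫ : ℝ))))) :
    ∫ p : E × E, windowedFourier φ ψ₂ p.1 p.2 * cexp (-(I * (⟪x - p.1, p.2⟫ : ℝ))) *
        (ψ₁ (t - (x - p.1)) * cexp (-(I * (⟪t, ξ - p.2⟫ : ℝ)))) =
      ((2 * π) ^ Module.finrank ℝ E : ℝ) * (∫ s, φ s * ψ₁ s) *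
        (ψ₂ (t - x) * cexp (-(I * (⟪t, ξ⟫ : ℝ)))) := by
  rw [Measure.volume_eq_prod] at hint ⊢
  rw [integral_prod _ hint]
  have h1 (y : E) : ∫ η, windowedFourier φ ψ₂ y η * cexp (-(I * (⟪x - y, η⟫ : ℝ))) *
        (ψ₁ (t - (x - y)) * cexp (-(I * (⟪t, ξ - η⟫ : ℝ)))) =
      ((2 * π) ^ Module.finrank ℝ E : ℝ) * (ψ₂ (t - x) * cexp (-(I * (⟪t, ξ⟫ : ℝ)))) *
        (φ (t - x + y) * ψ₁ (t - x + y)) := by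
    have h2 := integral_cexp_mul_windowedFourier φ ψ₂ y (t - x + y)
    rw [add_sub_cancel_right] at h2
    have h3 (η : E) : windowedFourier φ ψ₂ y η * cexp (-(I * (⟪x - y, η⟫ : ℝ))) *
        (ψ₁ (t - (x - y)) * cexp (-(I * (⟪t, ξ - η⟫ : ℝ)))) =
        ψ₁ (t - x + y) * cexp (-(I * (⟪t, ξ⟫ : ℝ))) *
          (cexp (I * (⟪t - x + y, η⟫ : ℝ)) * windowedFourier φ ψ₂ y η) := by
      have h4 : cexp (-(I * (⟪x - y, η⟫ : ℝ))) * cexp (-(I * (⟪t, ξ - η⟫ : ℝ))) =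
          cexp (-(I * (⟪t, ξ⟫ : ℝ))) * cexp (I * (⟪t - x + y, η⟫ : ℝ)) := by
        rw [← Complex.exp_add, ← Complex.exp_add]
        congr 1
        simp only [inner_sub_left, inner_sub_right, inner_add_left]
        push_cast
        ring
      rw [sub_sub_eq_add_sub, add_sub_right_comm]
      linear_combination (windowedFourier φ ψ₂ y η * ψ₁ (t - x + y)) * h4
    simp only [h3]
    rw [integral_const_mul, h2]
    ring
  simp only [h1]
  rw [integral_const_mul, integral_add_left_eq_self (fun s => φ s * ψ₁ s)]
  ring

theorem integrable_and_integral_twisted (f : 𝓢(E, ℂ) →L[ℂ] ℂ) (φ ψ₁ ψ₂ : 𝓢(E, ℂ))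
    {w₁ w₂ : E → E → 𝓢(E, ℂ)}
    (hw₁ : ∀ x ξ t, w₁ x ξ t = ψ₁ (t - x) * cexp (-(I * (⟪t, ξ⟫ : ℝ))))
    (hw₂ : ∀ x ξ t, w₂ x ξ t = ψ₂ (t - x) * cexp (-(I * (⟪t, ξ⟫ : ℝ)))) (x ξ : E) :
    Integrable (fun p : E × E => windowedFourier φ ψ₂ p.1 p.2 *
        cexp (-(I * (⟪x - p.1, p.2⟫ : ℝ))) * f (w₁ (x - p.1) (ξ - p.2))) ∧
      ∫ p : E × E, windowedFourier φ ψ₂ p.1 p.2 * cexp (-(I * (⟪x - p.1, p.2⟫ : ℝ))) *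
          f (w₁ (x - p.1) (ξ - p.2)) =
        ((2 * π) ^ Module.finrank ℝ E : ℝ) * (∫ s, φ s * ψ₁ s) * f (w₂ x ξ) := by
  set c : E × E → ℂ := fun p =>
    windowedFourier φ ψ₂ p.1 p.2 * cexp (-(I * (⟪x - p.1, p.2⟫ : ℝ))) with hc
  have hcont : Continuous c := (continuous_windowedFourier φ ψ₂).mul
    (contDiff_cexp_inner.continuous.comp
      ((continuous_const.sub continuous_fst).prodMk continuous_snd))
  set G : E × E → 𝓢(E, ℂ) := fun p => c p • w₁ (x - p.1) (ξ - p.2) with hGdef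
  have hG : Continuous G := hcont.smul ((continuous_timeFrequencyShift ψ₁ hw₁).comp
    ((continuous_const.sub continuous_fst).prodMk (continuous_const.sub continuous_snd)))
  have hint (k n : ℕ) : Integrable fun p => SchwartzMap.seminorm ℝ k n (G p) :=
    integrable_seminorm_timeFrequencyShift hw₁ x ξ k n hG fun p =>
      ⟨c p, by rw [hc, norm_mul, norm_cexp_inner, mul_one], rfl⟩
  have hGt (p : E × E) (t : E) : G p t =
      c p * (ψ₁ (t - (x - p.1)) * cexp (-(I * (⟪t, ξ - p.2⟫ : ℝ)))) := by
    rw [← hw₁]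
    rfl
  have hGint (t : E) : Integrable fun p => G p t := by
    refine (hint 0 0).mono' ?_ (.of_forall fun p => norm_le_seminorm ℝ _ t)
    have : Continuous fun g : 𝓢(E, ℂ) => iteratedFDeriv ℝ 0 g t := continuous_iteratedFDeriv_apply 0 t
    have h0 : Continuous fun p => (continuousMultilinearCurryFin0 ℝ E ℂ) (iteratedFDeriv ℝ 0 (G p) t) :=
      (LinearIsometryEquiv.continuous _).comp (this.comp hG)
    exact h0.aestronglyMeasurable
  have key := SchwartzMap.integrable_and_integral_eq f (μ := volume) hG hint
    (h := (((2 * π) ^ Module.finrank ℝ E : ℝ) * (∫ s, φ s * ψ₁ s)) • w₂ x ξ) fun t => by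
      have := hGint t
      simp only [hGt] at this ⊢
      rw [integral_timeFrequencyShift_twisted φ ψ₁ ψ₂ x ξ t this, ← hw₂]
      rfl
  simpa only [hGdef, map_smul, smul_eq_mul] using key

end TwistedConvolution

end SchwartzMap

/-- The pointwise complex conjugate of a Schwartz function. -/
noncomputable def SchwartzMap.conj {E : Type*} [NormedAddCommGroup E] [NormedSpace ℝ E]
    (φ : 𝓢(E, ℂ)) : 𝓢(E, ℂ) :=
  SchwartzMap.postcompCLM (𝕜 := ℝ) (conjCLE : ℂ →L[ℝ] ℂ) φ

theorem SchwartzMap.conj_apply {E : Type*} [NormedAddCommGroup E] [NormedSpace ℝ E]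
    (φ : 𝓢(E, ℂ)) (t : E) : φ.conj t = (starRingEnd ℂ) (φ t) := rfl

/-- Twisted convolution identity: (V_{φ₁} f) ⊛ (V_{φ₂} φ₃) = (φ₃, φ₁)_{L²} · V_{φ₂} f, the
twisted-convolution integral converging absolutely at every point. Here `w₁ x ξ`, `w₂ x ξ`
are the STFT windows for φ₁, φ₂, and V₁, V₂ the corresponding STFTs of the tempered
distribution f. -/
theorem stmt4 (d : ℕ) (f : SchwartzMap (Ed d) ℂ →L[ℂ] ℂ)
    (φ₁ φ₂ φ₃ : SchwartzMap (Ed d) ℂ)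
    (w₁ w₂ : Ed d → Ed d → SchwartzMap (Ed d) ℂ)
    (hw₁ : ∀ x ξ y : Ed d,
      w₁ x ξ y = (starRingEnd ℂ) (φ₁ (y - x)) * Complex.exp (-(Complex.I * (⟪y, ξ⟫ : ℝ))))
    (hw₂ : ∀ x ξ y : Ed d,
      w₂ x ξ y = (starRingEnd ℂ) (φ₂ (y - x)) * Complex.exp (-(Complex.I * (⟪y, ξ⟫ : ℝ))))
    (V₁ V₂ : Ed d → Ed d → ℂ)
    (hV₁ : ∀ x ξ : Ed d, V₁ x ξ = (((2 * π) ^ (-(d : ℝ) / 2) : ℝ) : ℂ) * f (w₁ x ξ))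
    (hV₂ : ∀ x ξ : Ed d, V₂ x ξ = (((2 * π) ^ (-(d : ℝ) / 2) : ℝ) : ℂ) * f (w₂ x ξ)) :
    ∀ x ξ : Ed d,
      Integrable (fun p : Ed d × Ed d =>
        V₁ (x - p.1) (ξ - p.2) * stftInt (⇑φ₂) (⇑φ₃) p.1 p.2 *
          Complex.exp (-(Complex.I * (⟪x - p.1, p.2⟫ : ℝ)))) ∧
      (((2 * π) ^ (-(d : ℝ) / 2) : ℝ) : ℂ) *
          ∫ p : Ed d × Ed d,
            V₁ (x - p.1) (ξ - p.2) * stftInt (⇑φ₂) (⇑φ₃) p.1 p.2 *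
              Complex.exp (-(Complex.I * (⟪x - p.1, p.2⟫ : ℝ)))
        = (∫ y : Ed d, φ₃ y * (starRingEnd ℂ) (φ₁ y)) * V₂ x ξ := by
  intro x ξ
  set c : ℂ := (((2 * π) ^ (-(d : ℝ) / 2) : ℝ) : ℂ) with hc
  obtain ⟨h1, h2⟩ := SchwartzMap.integrable_and_integral_twisted f φ₃ φ₁.conj φ₂.conj hw₁ hw₂ x ξ
  have heq (p : Ed d × Ed d) : V₁ (x - p.1) (ξ - p.2) * stftInt (⇑φ₂) (⇑φ₃) p.1 p.2 *
      cexp (-(I * (⟪x - p.1, p.2⟫ : ℝ))) =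
      c * c * (SchwartzMap.windowedFourier φ₃ φ₂.conj p.1 p.2 *
        cexp (-(I * (⟪x - p.1, p.2⟫ : ℝ))) * f (w₁ (x - p.1) (ξ - p.2))) := by
    have h3 : stftInt (⇑φ₂) (⇑φ₃) p.1 p.2 =
        c * SchwartzMap.windowedFourier φ₃ φ₂.conj p.1 p.2 := rfl
    rw [hV₁, h3]
    ring
  have hcc : c * c * ((2 * π) ^ d : ℝ) = 1 := by
    rw [hc, ← ofReal_mul, ← ofReal_mul, ← rpow_add (by positivity), ← rpow_natCast,
      ← rpow_add (by positivity)]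
    simp
  simp only [heq]
  refine ⟨h1.const_mul _, ?_⟩
  rw [integral_const_mul, h2, hV₂, finrank_euclideanSpace_fin]
  simp only [SchwartzMap.conj_apply]
  linear_combination (∫ y : Ed d, φ₃ y * (starRingEnd ℂ) (φ₁ y)) * (c * f (w₂ x ξ)) * hcc

end
end

section
/- Let f ∈ S'(ℝ^d) and φ₁, φ₂ ∈ S(ℝ^d). Then for all (x,ξ) ∈ ℝ^{2d} the integral below converges absolutely and V_{φ₁·conj(φ₂)} f(x,ξ) = (2π)^{-d/2} ∫_{ℝ^d} (V_{φ₁} f)(x, ξ−η) φ̂₂(η) e^{-i⟨x,η⟩} dη, where φ₁·conj(φ₂) denotes the pointwise product y ↦ φ₁(y) conj(φ₂(y)). -/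
open MeasureTheory Real Complex
open scoped RealInnerProductSpace

noncomputable section

open scoped SchwartzMap BoundedContinuousFunction FourierTransform

/-- A copy of the space of continuous `n`-linear forms `E [×n]→L[ℝ] ℂ`, with a single path of
instances to its norm, so that it can serve as the codomain of bounded continuous functions. -/
def MultilinearForms (E : Type*) [NormedAddCommGroup E] [NormedSpace ℝ E] (n : ℕ) : Type _ :=
  E [×n]→L[ℝ] ℂ

namespace MultilinearForms

variable (E : Type*) [NormedAddCommGroup E] [NormedSpace ℝ E] (n : ℕ)

instance : NormedAddCommGroup (MultilinearForms E n) :=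
  inferInstanceAs (NormedAddCommGroup (E [×n]→L[ℝ] ℂ))

instance : NormedSpace ℂ (MultilinearForms E n) :=
  inferInstanceAs (NormedSpace ℂ (E [×n]→L[ℝ] ℂ))

instance : CompleteSpace (MultilinearForms E n) :=
  inferInstanceAs (CompleteSpace (E [×n]→L[ℝ] ℂ))

/-- The `n`-th derivative of a function, as an element of `MultilinearForms E n`. -/
def iteratedDerivative {E : Type*} [NormedAddCommGroup E] [NormedSpace ℝ E] (n : ℕ)
    (g : E → ℂ) (y : E) : MultilinearForms E n :=
  iteratedFDeriv ℝ n g y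

end MultilinearForms

open MultilinearForms

/-- The weighted derivative `y ↦ ‖y‖ ^ k • D^n g y` of a Schwartz function, as a bounded continuous
function. Its sup norm is the `(k, n)`-th Schwartz seminorm of `g`. -/
def weightedIteratedFDeriv {E : Type*} [NormedAddCommGroup E] [NormedSpace ℝ E] (k n : ℕ) :
    𝓢(E, ℂ) →ₗ[ℂ] (E →ᵇ MultilinearForms E n) where
  toFun g := BoundedContinuousFunction.ofNormedAddCommGroup
    (fun y => ((‖y‖ ^ k : ℝ) : ℂ) • iteratedDerivative n g y)
    ((continuous_ofReal.comp (continuous_norm.pow k)).smul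
      ((g.smooth ⊤).continuous_iteratedFDeriv (mod_cast le_top)))
    (SchwartzMap.seminorm ℂ k n g)
    (fun y => by
      rw [norm_smul, norm_real, norm_pow, norm_norm]
      exact SchwartzMap.le_seminorm ℂ k n g y)
  map_add' g h := by
    ext1 y
    have : iteratedDerivative n (⇑(g + h)) y = iteratedDerivative n g y + iteratedDerivative n h y :=
      iteratedFDeriv_add_apply (g.contDiffAt n) (h.contDiffAt n)
    exact (congrArg _ this).trans (smul_add _ _ _)
  map_smul' c g := by
    ext1 y
    have : iteratedDerivative n (⇑(c • g)) y = c • iteratedDerivative n g y :=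
      iteratedFDeriv_const_smul_apply (g.contDiffAt n)
    exact (congrArg _ this).trans (smul_comm _ _ _)

section

variable {E : Type*} [NormedAddCommGroup E] [NormedSpace ℝ E]

theorem weightedIteratedFDeriv_apply (k n : ℕ) (g : 𝓢(E, ℂ)) (y : E) :
    weightedIteratedFDeriv k n g y = ((‖y‖ ^ k : ℝ) : ℂ) • iteratedDerivative n g y := rfl

theorem norm_weightedIteratedFDeriv_apply (k n : ℕ) (g : 𝓢(E, ℂ)) (y : E) :
    ‖weightedIteratedFDeriv k n g y‖ = ‖y‖ ^ k * ‖iteratedFDeriv ℝ n g y‖ := by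
  rw [weightedIteratedFDeriv_apply, norm_smul, norm_real, norm_pow, norm_norm]
  rfl

theorem norm_weightedIteratedFDeriv_le (k n : ℕ) (g : 𝓢(E, ℂ)) :
    ‖weightedIteratedFDeriv k n g‖ ≤ SchwartzMap.seminorm ℂ k n g := by
  refine (BoundedContinuousFunction.norm_le (apply_nonneg _ _)).2 fun y => ?_
  rw [norm_weightedIteratedFDeriv_apply]
  exact SchwartzMap.le_seminorm ℂ k n g y

theorem seminorm_le_norm_weightedIteratedFDeriv (k n : ℕ) (g : 𝓢(E, ℂ)) :
    SchwartzMap.seminorm ℂ k n g ≤ ‖weightedIteratedFDeriv k n g‖ := by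
  refine SchwartzMap.seminorm_le_bound ℂ k n g (norm_nonneg _) fun y => ?_
  rw [← norm_weightedIteratedFDeriv_apply]
  exact (weightedIteratedFDeriv k n g).norm_coe_le_norm y

theorem continuous_weightedIteratedFDeriv (k n : ℕ) :
    Continuous (weightedIteratedFDeriv (E := E) k n) := by
  refine (schwartz_withSeminorms ℂ E ℂ).continuous_normedSpace_rng _ _
    ⟨{(k, n)}, 1, fun g => ?_⟩
  simpa using! norm_weightedIteratedFDeriv_le k n g

/-- A continuous linear functional on Schwartz space factors through finitely many of the maps
`weightedIteratedFDeriv`. -/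
theorem exists_factor_weightedIteratedFDeriv (f : 𝓢(E, ℂ) →L[ℂ] ℂ) :
    ∃ (s : Finset (ℕ × ℕ)) (F : StrongDual ℂ (∀ i : s, E →ᵇ MultilinearForms E i.1.2)),
      ∀ g, f g = F (fun i => weightedIteratedFDeriv i.1.1 i.1.2 g) := by
  obtain ⟨s, C, -, hC⟩ := Seminorm.bound_of_continuous (schwartz_withSeminorms ℂ E ℂ)
    ((normSeminorm ℂ ℂ).comp (f : 𝓢(E, ℂ) →ₗ[ℂ] ℂ)) (continuous_norm.comp f.continuous)
  let Φ : 𝓢(E, ℂ) →ₗ[ℂ] (∀ i : s, E →ᵇ MultilinearForms E i.1.2) :=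
    LinearMap.pi fun i => weightedIteratedFDeriv i.1.1 i.1.2
  have hf : ∀ g, ‖f g‖ ≤ C * ‖Φ g‖ := fun g => by
    refine (hC g).trans ?_
    change C * (s.sup (schwartzSeminormFamily ℂ E ℂ)) g ≤ _
    gcongr
    refine Seminorm.finset_sup_apply_le (norm_nonneg _) fun i hi => ?_
    exact (seminorm_le_norm_weightedIteratedFDeriv i.1 i.2 g).trans
      (norm_le_pi_norm (Φ g) ⟨i, hi⟩)
  have hker : Φ.ker ≤ (f : 𝓢(E, ℂ) →ₗ[ℂ] ℂ).ker := fun g hg => by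
    have h := hf g
    rw [LinearMap.mem_ker.1 hg] at h
    simpa using! h
  let f' : Φ.range →ₗ[ℂ] ℂ := (Φ.ker.liftQ _ hker) ∘ₗ Φ.quotKerEquivRange.symm.toLinearMap
  have hf' : ∀ g, f' ⟨Φ g, g, rfl⟩ = f g := fun g => by
    have : Φ.quotKerEquivRange.symm ⟨Φ g, g, rfl⟩ = Φ.ker.mkQ g :=
      Φ.quotKerEquivRange_symm_apply_image g _
    simp [f', this]
  obtain ⟨F, hF, -⟩ := exists_extension_norm_eq Φ.range (f'.mkContinuous C (by
    rintro ⟨_, g, rfl⟩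
    rw [hf']
    exact hf g))
  exact ⟨s, F, fun g => ((hF ⟨Φ g, g, rfl⟩).trans (hf' g)).symm⟩

variable {α : Type*} [TopologicalSpace α] [MeasurableSpace α] [OpensMeasurableSpace α]
  [SecondCountableTopology α]
  {μ : Measure α} {U : α → 𝓢(E, ℂ)}

theorem integrable_weightedIteratedFDeriv (hU : Continuous U) {k n : ℕ}
    (hint : Integrable (fun η => SchwartzMap.seminorm ℂ k n (U η)) μ) :
    Integrable (fun η => weightedIteratedFDeriv k n (U η)) μ :=
  hint.mono' ((continuous_weightedIteratedFDeriv k n).comp hU).aestronglyMeasurable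
    (.of_forall fun η => norm_weightedIteratedFDeriv_le k n (U η))

theorem integrable_iteratedFDeriv (hU : Continuous U) {n : ℕ}
    (hint : Integrable (fun η => SchwartzMap.seminorm ℂ 0 n (U η)) μ) (y : E) :
    Integrable (fun η => iteratedFDeriv ℝ n (U η) y) μ := by
  have := (BoundedContinuousFunction.evalCLM ℂ y).integrable_comp
    (integrable_weightedIteratedFDeriv hU hint)
  simp only [BoundedContinuousFunction.evalCLM_apply, weightedIteratedFDeriv_apply, pow_zero,
    ofReal_one, one_smul] at this
  exact this

/-- Differentiation under the integral sign for a parametric integral of Schwartz functions. -/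
theorem iteratedFDeriv_integral_schwartz (hU : Continuous U)
    (hint : ∀ k n, Integrable (fun η => SchwartzMap.seminorm ℂ k n (U η)) μ)
    {g : E → ℂ} (hg : ∀ y, g y = ∫ η, U η y ∂μ) (n : ℕ) (y : E) :
    iteratedFDeriv ℝ n g y = ∫ η, iteratedFDeriv ℝ n (U η) y ∂μ := by
  induction n generalizing y with
  | zero =>
    have := ((continuousMultilinearCurryFin0 ℝ E ℂ).symm.toContinuousLinearEquiv :
      ℂ ≃L[ℝ] _).integral_comp_comm (μ := μ) (fun η => U η y)
    rw [iteratedFDeriv_zero_eq_comp, Function.comp_apply, hg]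
    simpa [iteratedFDeriv_zero_eq_comp] using! this.symm
  | succ n ih =>
    have hI := integrable_iteratedFDeriv hU (hint 0 (n + 1)) y
    let L : (E [×n + 1]→L[ℝ] ℂ) ≃ₗᵢ[ℝ] (E →L[ℝ] (E [×n]→L[ℝ] ℂ)) :=
      continuousMultilinearCurryLeftEquiv ℝ (fun _ : Fin (n + 1) => E) ℂ
    have hderiv : HasFDerivAt (fun z => ∫ η, iteratedFDeriv ℝ n (U η) z ∂μ)
        (∫ η, fderiv ℝ (iteratedFDeriv ℝ n (U η)) y ∂μ) y := by
      refine hasFDerivAt_integral_of_dominated_of_fderiv_le (s := Set.univ) Filter.univ_mem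
        (bound := fun η => SchwartzMap.seminorm ℂ 0 (n + 1) (U η))
        (F' := fun z η => fderiv ℝ (iteratedFDeriv ℝ n (U η)) z)
        (.of_forall fun z => (integrable_iteratedFDeriv hU (hint 0 n) z).aestronglyMeasurable)
        (integrable_iteratedFDeriv hU (hint 0 n) y) ?_
        (.of_forall fun η z _ => ?_) (hint 0 (n + 1)) (.of_forall fun η z _ => ?_)
      · simp_rw [fderiv_iteratedFDeriv]
        exact L.continuous.comp_aestronglyMeasurable hI.aestronglyMeasurable
      · rw [norm_fderiv_iteratedFDeriv]
        exact SchwartzMap.norm_iteratedFDeriv_le_seminorm ℂ (U η) (n + 1) z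
      · exact ((((U η).smooth ⊤).differentiable_iteratedFDeriv (m := n)
          (mod_cast WithTop.coe_lt_top _)) z).hasFDerivAt
    have hg' : iteratedFDeriv ℝ n g = fun z => ∫ η, iteratedFDeriv ℝ n (U η) z ∂μ := funext ih
    rw [iteratedFDeriv_succ_eq_comp_left, Function.comp_apply, hg', hderiv.fderiv]
    simp_rw [fderiv_iteratedFDeriv]
    have := ContinuousLinearEquiv.integral_comp_comm (𝕜 := ℝ) (E := E [×n + 1]→L[ℝ] ℂ)
      (F := E →L[ℝ] (E [×n]→L[ℝ] ℂ)) (μ := μ) L.toContinuousLinearEquiv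
      (fun η => iteratedFDeriv ℝ (n + 1) (U η) y)
    exact (congrArg L.symm this).trans (L.symm_apply_apply _)

/-- Tempered distributions commute with absolutely convergent integrals of Schwartz functions. -/
theorem integrable_and_map_eq_integral_schwartz (f : 𝓢(E, ℂ) →L[ℂ] ℂ) (hU : Continuous U)
    (hint : ∀ k n, Integrable (fun η => SchwartzMap.seminorm ℂ k n (U η)) μ)
    {g : 𝓢(E, ℂ)} (hg : ∀ y, g y = ∫ η, U η y ∂μ) :
    Integrable (fun η => f (U η)) μ ∧ f g = ∫ η, f (U η) ∂μ := by
  obtain ⟨s, F, hF⟩ := exists_factor_weightedIteratedFDeriv f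
  have hcomp (i : s) : Integrable (fun η => weightedIteratedFDeriv i.1.1 i.1.2 (U η)) μ :=
    integrable_weightedIteratedFDeriv hU (hint _ _)
  have hΦ : Integrable (fun η => fun i : s => weightedIteratedFDeriv i.1.1 i.1.2 (U η)) μ :=
    Integrable.of_eval hcomp
  simp_rw [hF]
  refine ⟨F.integrable_comp hΦ, ?_⟩
  rw [F.integral_comp_comm hΦ]
  congr 1
  funext i
  rw [eval_integral hcomp]
  ext1 y
  have h := ((BoundedContinuousFunction.evalCLM ℂ y).integral_comp_comm (hcomp i))
  rw [BoundedContinuousFunction.evalCLM_apply] at h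
  rw [← h]
  simp_rw [BoundedContinuousFunction.evalCLM_apply, weightedIteratedFDeriv_apply]
  rw [integral_smul]
  exact congrArg _ (iteratedFDeriv_integral_schwartz hU hint hg i.1.2 y)

end

/-- The plane wave `y ↦ exp (-i⟪y, ζ⟫)`. -/
def planeWave {d : ℕ} (ζ y : Ed d) : ℂ := Complex.exp (-(Complex.I * (⟪y, ζ⟫ : ℝ)))

section

variable {d : ℕ}

theorem norm_planeWave (ζ y : Ed d) : ‖planeWave ζ y‖ = 1 := by
  rw [planeWave, ← mul_neg, ← ofReal_neg, mul_comm, norm_exp_ofReal_mul_I]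

theorem planeWave_add (ζ ζ' y : Ed d) : planeWave (ζ + ζ') y = planeWave ζ y * planeWave ζ' y := by
  rw [planeWave, planeWave, planeWave, ← Complex.exp_add, inner_add_right]
  push_cast
  ring_nf

theorem contDiff_planeWave (ζ : Ed d) : ContDiff ℝ (⊤ : ℕ∞) (planeWave ζ) := by
  unfold planeWave
  refine ContDiff.cexp (contDiff_const.mul (ofRealCLM.contDiff.comp ?_)).neg
  exact contDiff_id.inner ℝ contDiff_const

theorem hasFDerivAt_planeWave (ζ y : Ed d) :
    HasFDerivAt (planeWave ζ)
      (planeWave ζ y • (-Complex.I • ofRealCLM.comp (innerSL ℝ ζ) : Ed d →L[ℝ] ℂ)) y := by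
  have h : HasFDerivAt (fun z : Ed d => -(Complex.I * (⟪z, ζ⟫ : ℝ)))
      (-Complex.I • ofRealCLM.comp (innerSL ℝ ζ) : Ed d →L[ℝ] ℂ) y := by
    convert (-Complex.I • ofRealCLM.comp (innerSL ℝ ζ) : Ed d →L[ℝ] ℂ).hasFDerivAt using 1
    ext z
    simp [real_inner_comm]
  exact h.cexp

theorem norm_iteratedFDeriv_planeWave_le (ζ : Ed d) (n : ℕ) (y : Ed d) :
    ‖iteratedFDeriv ℝ n (planeWave ζ) y‖ ≤ ‖ζ‖ ^ n := by
  induction n generalizing y with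
  | zero => simp [norm_planeWave]
  | succ n ih =>
    let ℓ : Ed d →L[ℝ] ℂ := -Complex.I • ofRealCLM.comp (innerSL ℝ ζ)
    let L : ℂ →L[ℝ] (Ed d →L[ℝ] ℂ) := (ContinuousLinearMap.id ℝ ℂ).smulRight ℓ
    have hℓ : ‖ℓ‖ ≤ ‖ζ‖ := by
      refine ContinuousLinearMap.opNorm_le_bound _ (norm_nonneg _) fun z => ?_
      simpa [ℓ] using abs_real_inner_le_norm ζ z
    have hL : ‖L‖ ≤ ‖ζ‖ := by
      refine ContinuousLinearMap.opNorm_le_bound _ (norm_nonneg _) fun z => ?_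
      change ‖z • ℓ‖ ≤ _
      rw [norm_smul, mul_comm]
      gcongr
    have hfd : fderiv ℝ (planeWave ζ) = L ∘ planeWave ζ :=
      funext fun z => (hasFDerivAt_planeWave ζ z).fderiv
    rw [← norm_iteratedFDeriv_fderiv, hfd, pow_succ']
    exact (L.norm_iteratedFDeriv_comp_left (contDiff_planeWave ζ).contDiffAt
      (mod_cast le_top)).trans (mul_le_mul hL (ih y) (norm_nonneg _) (norm_nonneg _))

theorem norm_planeWave_sub_one_le (ζ y : Ed d) : ‖planeWave ζ y - 1‖ ≤ ‖ζ‖ * ‖y‖ := by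
  have h : planeWave ζ y = Complex.exp (Complex.I * (-⟪y, ζ⟫ : ℝ)) := by
    rw [planeWave]; push_cast; ring_nf
  rw [h]
  refine (Real.norm_exp_I_mul_ofReal_sub_one_le).trans ?_
  rw [norm_neg, mul_comm]
  exact norm_inner_le_norm y ζ

theorem norm_iteratedFDeriv_planeWave_sub_one_le {ζ : Ed d} (hζ : ‖ζ‖ ≤ 1) (n : ℕ) (y : Ed d) :
    ‖iteratedFDeriv ℝ n (fun z => planeWave ζ z - 1) y‖ ≤ ‖ζ‖ * (1 + ‖y‖) := by
  cases n with
  | zero =>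
    rw [norm_iteratedFDeriv_zero]
    refine (norm_planeWave_sub_one_le ζ y).trans ?_
    gcongr
    linarith
  | succ n =>
    rw [← norm_iteratedFDeriv_fderiv]
    have : fderiv ℝ (fun z => planeWave ζ z - 1) = fderiv ℝ (planeWave ζ) :=
      funext fun z => fderiv_sub_const 1
    rw [this, norm_iteratedFDeriv_fderiv]
    refine (norm_iteratedFDeriv_planeWave_le ζ (n + 1) y).trans ?_
    rw [pow_succ']
    gcongr
    exact (pow_le_one₀ (norm_nonneg _) hζ).trans (by simp)

/-- A product of a Schwartz function with a smooth function whose derivatives are bounded by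
`A * (1 + ‖y‖)` has Schwartz seminorms bounded by `A`, up to a constant. -/
theorem seminorm_mul_le {e : Ed d → ℂ} (he : ContDiff ℝ (⊤ : ℕ∞) e) {u g : 𝓢(Ed d, ℂ)}
    (hg : ∀ y, g y = e y * u y) {A : ℝ} (hA : 0 ≤ A) (k n : ℕ)
    (hbound : ∀ j ≤ n, ∀ y, ‖iteratedFDeriv ℝ j e y‖ ≤ A * (1 + ‖y‖)) :
    SchwartzMap.seminorm ℂ k n g ≤ A * ∑ j ∈ Finset.range (n + 1), (n.choose j : ℝ) *
      (SchwartzMap.seminorm ℂ k (n - j) u + SchwartzMap.seminorm ℂ (k + 1) (n - j) u) := by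
  refine SchwartzMap.seminorm_le_bound ℂ k n g (by positivity) fun y => ?_
  rw [show (g : Ed d → ℂ) = fun y => e y * u y from funext hg]
  refine (mul_le_mul_of_nonneg_left (norm_iteratedFDeriv_mul_le he (u.smooth ⊤) y
    (mod_cast le_top)) (by positivity)).trans ?_
  rw [Finset.mul_sum, Finset.mul_sum]
  refine Finset.sum_le_sum fun j hj => ?_
  have h1 := SchwartzMap.le_seminorm ℂ k (n - j) u y
  have h2 := SchwartzMap.le_seminorm ℂ (k + 1) (n - j) u y
  calc ‖y‖ ^ k * (n.choose j * ‖iteratedFDeriv ℝ j e y‖ * ‖iteratedFDeriv ℝ (n - j) u y‖)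
      ≤ ‖y‖ ^ k * (n.choose j * (A * (1 + ‖y‖)) * ‖iteratedFDeriv ℝ (n - j) u y‖) := by
        gcongr
        exact hbound j (by simpa [Nat.lt_succ_iff] using hj) y
    _ = A * (n.choose j * (‖y‖ ^ k * ‖iteratedFDeriv ℝ (n - j) u y‖ +
          ‖y‖ ^ (k + 1) * ‖iteratedFDeriv ℝ (n - j) u y‖)) := by ring
    _ ≤ _ := by gcongr

variable {u : 𝓢(Ed d, ℂ)} {w : Ed d → 𝓢(Ed d, ℂ)}

/-- Modulations of a Schwartz function have polynomially bounded seminorms. -/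
theorem exists_seminorm_modulation_le (hw : ∀ ζ y, w ζ y = planeWave ζ y * u y) (k n : ℕ) :
    ∃ C, 0 ≤ C ∧ ∀ ζ, SchwartzMap.seminorm ℂ k n (w ζ) ≤ (1 + ‖ζ‖) ^ n * C := by
  refine ⟨_, ?_, fun ζ => seminorm_mul_le (contDiff_planeWave ζ) (hw ζ) (by positivity) k n ?_⟩
  · positivity
  · intro j hj y
    refine (norm_iteratedFDeriv_planeWave_le ζ j y).trans ?_
    calc ‖ζ‖ ^ j ≤ (1 + ‖ζ‖) ^ j := by gcongr; linarith
      _ ≤ (1 + ‖ζ‖) ^ n := pow_le_pow_right₀ (by linarith [norm_nonneg ζ]) hj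
      _ ≤ _ := le_mul_of_one_le_right (by positivity) (by linarith [norm_nonneg y])

/-- Modulations of a Schwartz function depend continuously on the frequency. -/
theorem continuous_modulation (hw : ∀ ζ y, w ζ y = planeWave ζ y * u y) : Continuous w := by
  rw [continuous_iff_continuousAt]
  intro ζ
  rw [ContinuousAt, (schwartz_withSeminorms ℂ (Ed d) ℂ).tendsto_nhds]
  rintro ⟨k, n⟩ ε hε
  set C := ∑ j ∈ Finset.range (n + 1), (n.choose j : ℝ) *
    (SchwartzMap.seminorm ℂ k (n - j) (w ζ) + SchwartzMap.seminorm ℂ (k + 1) (n - j) (w ζ))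
  have hlim : Filter.Tendsto (fun ζ' => ‖ζ' - ζ‖ * C) (nhds ζ) (nhds 0) := by
    have : Continuous fun ζ' => ‖ζ' - ζ‖ * C := by fun_prop
    simpa using this.tendsto ζ
  filter_upwards [hlim.eventually_lt_const hε, Metric.ball_mem_nhds ζ one_pos] with ζ' h hball
  refine lt_of_le_of_lt ?_ h
  have hle : ‖ζ' - ζ‖ ≤ 1 := by
    rw [← dist_eq_norm]
    exact (Metric.mem_ball.1 hball).le
  refine seminorm_mul_le (e := fun z => planeWave (ζ' - ζ) z - 1)
    ((contDiff_planeWave _).sub contDiff_const) (fun y => ?_) (norm_nonneg _) k n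
    fun j _ y => norm_iteratedFDeriv_planeWave_sub_one_le hle j y
  have : planeWave ζ' y = planeWave (ζ' - ζ) y * planeWave ζ y := by
    rw [← planeWave_add, sub_add_cancel]
  rw [_root_.sub_apply, hw, hw, this]
  ring

/-- The rescaled Fourier transform `η ↦ 𝓕 φ (η / 2π)` of a Schwartz function. -/
def scaledFourier (φ : 𝓢(Ed d, ℂ)) : 𝓢(Ed d, ℂ) :=
  SchwartzMap.compCLMOfContinuousLinearEquiv ℂ
    (ContinuousLinearEquiv.smulLeft (Units.mk0 ((2 * π)⁻¹ : ℝ) (by positivity))) (𝓕 φ)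

theorem scaledFourier_apply (φ : 𝓢(Ed d, ℂ)) (η : Ed d) :
    scaledFourier φ η = 𝓕 (φ : Ed d → ℂ) ((2 * π)⁻¹ • η) := rfl

theorem fourierInt_eq_scaledFourier (φ : 𝓢(Ed d, ℂ)) (η : Ed d) :
    fourierInt φ η = (((2 * π) ^ (-(d : ℝ) / 2) : ℝ) : ℂ) * scaledFourier φ η := by
  rw [fourierInt, scaledFourier_apply, Real.fourier_eq']
  congr 2 with y
  rw [smul_eq_mul, mul_comm, inner_smul_right]
  congr 2
  have : (π : ℂ) ≠ 0 := ofReal_ne_zero.2 pi_ne_zero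
  push_cast
  field_simp

/-- Fourier inversion in the normalization of `fourierInt`. -/
theorem integral_fourierInt_mul_planeWave (φ : 𝓢(Ed d, ℂ)) (z : Ed d) :
    (((2 * π) ^ (-(d : ℝ) / 2) : ℝ) : ℂ) * ∫ η, fourierInt φ η * planeWave (-z) η = φ z := by
  have hinv : 𝓕⁻ (𝓕 (φ : Ed d → ℂ)) z = φ z := by
    rw [φ.continuous.fourierInv_fourier_eq φ.integrable (𝓕 φ).integrable]
  have hscale := Measure.integral_comp_inv_smul (volume : Measure (Ed d))
    (fun v => Complex.exp (↑(2 * π * ⟪v, z⟫) * Complex.I) • 𝓕 (φ : Ed d → ℂ) v) (2 * π)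
  rw [← Real.fourierInv_eq', hinv] at hscale
  have hint (η : Ed d) : fourierInt φ η * planeWave (-z) η = (((2 * π) ^ (-(d : ℝ) / 2) : ℝ) : ℂ) *
      Complex.exp (↑(2 * π * ⟪(2 * π)⁻¹ • η, z⟫) * Complex.I) •
        𝓕 (φ : Ed d → ℂ) ((2 * π)⁻¹ • η) := by
    rw [fourierInt_eq_scaledFourier, scaledFourier_apply, planeWave, inner_smul_left, smul_eq_mul,
      mul_assoc, mul_comm (𝓕 (φ : Ed d → ℂ) _)]
    congr 3
    have : (π : ℂ) ≠ 0 := ofReal_ne_zero.2 pi_ne_zero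
    simp
    field_simp
  simp_rw [hint]
  rw [integral_const_mul, hscale, finrank_euclideanSpace_fin, ← mul_assoc, ← ofReal_mul,
    ← Real.rpow_add (by positivity), real_smul, ← mul_assoc, ← ofReal_mul,
    abs_of_pos (by positivity), ← Real.rpow_natCast, ← Real.rpow_add (by positivity)]
  ring_nf
  simp

end

/-- STFT with product window: V_{φ₁·conj(φ₂)} f(x,ξ) = (2π)^{-d/2} ∫ V_{φ₁}f(x,ξ−η) φ̂₂(η)
e^{-i⟨x,η⟩} dη, the integral converging absolutely. Here `w₁ x ξ` is the window for φ₁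
and `w x ξ` the window for the product φ₁·conj(φ₂). -/
theorem stmt5 (d : ℕ) (f : SchwartzMap (Ed d) ℂ →L[ℂ] ℂ)
    (φ₁ φ₂ : SchwartzMap (Ed d) ℂ)
    (w₁ w : Ed d → Ed d → SchwartzMap (Ed d) ℂ)
    (hw₁ : ∀ x ξ y : Ed d,
      w₁ x ξ y = (starRingEnd ℂ) (φ₁ (y - x)) * Complex.exp (-(Complex.I * (⟪y, ξ⟫ : ℝ))))
    (hw : ∀ x ξ y : Ed d,
      w x ξ y = (starRingEnd ℂ) (φ₁ (y - x) * (starRingEnd ℂ) (φ₂ (y - x))) *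
        Complex.exp (-(Complex.I * (⟪y, ξ⟫ : ℝ))))
    (V₁ : Ed d → Ed d → ℂ)
    (hV₁ : ∀ x ξ : Ed d, V₁ x ξ = (((2 * π) ^ (-(d : ℝ) / 2) : ℝ) : ℂ) * f (w₁ x ξ)) :
    ∀ x ξ : Ed d,
      Integrable (fun η : Ed d =>
        V₁ x (ξ - η) * fourierInt (⇑φ₂) η * Complex.exp (-(Complex.I * (⟪x, η⟫ : ℝ)))) ∧
      (((2 * π) ^ (-(d : ℝ) / 2) : ℝ) : ℂ) * f (w x ξ)
        = (((2 * π) ^ (-(d : ℝ) / 2) : ℝ) : ℂ) *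
            ∫ η : Ed d,
              V₁ x (ξ - η) * fourierInt (⇑φ₂) η *
                Complex.exp (-(Complex.I * (⟪x, η⟫ : ℝ))) := by
  intro x ξ
  set K : ℂ := (((2 * π) ^ (-(d : ℝ) / 2) : ℝ) : ℂ) with hK
  have hw₁_mod (ζ y : Ed d) : w₁ x ζ y = planeWave ζ y * w₁ x 0 y := by
    simp [hw₁, planeWave, mul_comm]
  let c : Ed d → ℂ := fun η => K * fourierInt φ₂ η * planeWave η x
  have hc_eq (η : Ed d) : c η = K * K * scaledFourier φ₂ η * planeWave η x := by
    simp only [c, fourierInt_eq_scaledFourier, hK]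
    ring
  have hc_cont : Continuous c := by
    have : Continuous fun η : Ed d => planeWave η x := by
      unfold planeWave
      fun_prop
    rw [show c = _ from funext hc_eq]
    exact (continuous_const.mul (scaledFourier φ₂).continuous).mul this
  have hU : Continuous fun η => c η • w₁ x (ξ - η) :=
    hc_cont.smul ((continuous_modulation hw₁_mod).comp (continuous_const.sub continuous_id))
  have hint (k n : ℕ) :
      Integrable (fun η => SchwartzMap.seminorm ℂ k n (c η • w₁ x (ξ - η))) := by
    obtain ⟨C, hC, hle⟩ := exists_seminorm_modulation_le hw₁_mod k n
    have hpoly : Integrable fun η : Ed d => (1 + ‖ξ‖ + ‖η‖) ^ n * ‖scaledFourier φ₂ η‖ := by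
      simp_rw [add_pow _ ‖_‖ n, Finset.sum_mul]
      refine integrable_finsetSum _ fun j _ => ?_
      refine (((scaledFourier φ₂).integrable_pow_mul volume (n - j)).const_mul
        ((1 + ‖ξ‖) ^ j * n.choose j)).congr (.of_forall fun η => ?_)
      ring
    refine (hpoly.const_mul (‖K * K‖ * C)).mono'
      (((schwartz_withSeminorms ℂ (Ed d) ℂ).continuous_seminorm (k, n)).comp
        hU).aestronglyMeasurable (.of_forall fun η => ?_)
    rw [Real.norm_of_nonneg (apply_nonneg _ _), map_smul_eq_mul, hc_eq, norm_mul, norm_planeWave,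
      mul_one, norm_mul]
    calc ‖K * K‖ * ‖scaledFourier φ₂ η‖ * SchwartzMap.seminorm ℂ k n (w₁ x (ξ - η))
        ≤ ‖K * K‖ * ‖scaledFourier φ₂ η‖ * ((1 + ‖ξ‖ + ‖η‖) ^ n * C) := by
          gcongr
          refine (hle _).trans ?_
          have : 1 + ‖ξ - η‖ ≤ 1 + ‖ξ‖ + ‖η‖ := by linarith [norm_sub_le ξ η]
          gcongr
      _ = _ := by ring
  have hw_int (y : Ed d) : w x ξ y = ∫ η, (c η • w₁ x (ξ - η)) y := by
    have (η : Ed d) : (c η • w₁ x (ξ - η)) y =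
        w₁ x ξ y * K * (fourierInt φ₂ η * planeWave (-(y - x)) η) := by
      have hxy : planeWave η x * planeWave (ξ - η) y = planeWave (-(y - x)) η * planeWave ξ y := by
        simp only [planeWave, ← Complex.exp_add, inner_sub_right, inner_neg_right,
          real_inner_comm η]
        push_cast
        ring_nf
      change c η * w₁ x (ξ - η) y = _
      rw [hw₁_mod (ξ - η), hw₁_mod ξ]
      linear_combination K * fourierInt φ₂ η * w₁ x 0 y * hxy
    simp_rw [this]
    rw [integral_const_mul, mul_assoc, hK, integral_fourierInt_mul_planeWave, hw, hw₁, map_mul,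
      Complex.conj_conj]
    ring
  have hfU (η : Ed d) : f (c η • w₁ x (ξ - η)) = V₁ x (ξ - η) * fourierInt (⇑φ₂) η *
      Complex.exp (-(Complex.I * (⟪x, η⟫ : ℝ))) := by
    rw [map_smul, smul_eq_mul, hV₁]
    simp only [c, planeWave]
    ring
  have hmain := integrable_and_map_eq_integral_schwartz f hU hint hw_int
  simp_rw [hfU] at hmain
  exact ⟨hmain.1, congrArg (K * ·) hmain.2⟩

end
end

section
/- Let f ∈ S'(ℝ^d) and φ₁, φ₂ ∈ S(ℝ^d). Then for all (x,ξ) ∈ ℝ^{2d} the integral below converges absolutely and V_{φ₁ * φ̃₂} f(x,ξ) = ∫_{ℝ^d} (V_{φ₁} f)(x−y, ξ) φ₂(y) dy, where φ̃₂(x) = conj(φ₂(−x)) and (φ₁ * φ̃₂)(x) = ∫_{ℝ^d} φ₁(x−z) φ̃₂(z) dz is the convolution. -/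
open MeasureTheory Real Complex
open scoped RealInnerProductSpace

noncomputable section

namespace SchwartzMap

open scoped SchwartzMap BoundedContinuousFunction Topology
open Filter

section General

variable {E F : Type*} [NormedAddCommGroup E] [NormedSpace ℝ E]
  [NormedAddCommGroup F] [NormedSpace ℝ F]

/-- Bounded continuous functions, with the metric of the codomain induced by its norm group. -/
abbrev BoundedMap (X G : Type*) [TopologicalSpace X] [NormedAddCommGroup G] := X →ᵇ G

lemma contDiff_iteratedFDeriv (g : 𝓢(E, F)) (n : ℕ) {m : ℕ∞} :
    ContDiff ℝ m (iteratedFDeriv ℝ n g) :=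
  (g.smooth ⊤).iteratedFDeriv_right (by exact_mod_cast le_top)

lemma norm_fderiv_iteratedFDeriv_le (𝕜 : Type*) [NormedField 𝕜] [NormedSpace 𝕜 F]
    [SMulCommClass ℝ 𝕜 F] (g : 𝓢(E, F)) (k n : ℕ) (t : E) :
    ‖t‖ ^ k * ‖fderiv ℝ (iteratedFDeriv ℝ n g) t‖ ≤ SchwartzMap.seminorm 𝕜 k (n + 1) g := by
  rw [norm_fderiv_iteratedFDeriv]
  exact g.le_seminorm 𝕜 k (n + 1) t

lemma norm_add_pow_le {E : Type*} [SeminormedAddGroup E] (k : ℕ) (s u : E) :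
    ‖s + u‖ ^ k ≤ 2 ^ (k - 1) * (‖s‖ ^ k + ‖u‖ ^ k) :=
  (pow_le_pow_left₀ (norm_nonneg _) (norm_add_le s u) k).trans
    (add_pow_le (norm_nonneg _) (norm_nonneg _) k)

lemma pow_mul_norm_sub_le {h : E → F} (hdiff : Differentiable ℝ h) {k : ℕ} {M : ℝ} {t a : E}
    (hM : ∀ s ∈ Metric.closedBall t 1, ‖t‖ ^ k * ‖fderiv ℝ h s‖ ≤ M) (ha : ‖a‖ ≤ 1) :
    ‖t‖ ^ k * ‖h (t - a) - h t‖ ≤ M * ‖a‖ := by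
  have := (convex_closedBall t 1).norm_image_sub_le_of_norm_fderiv_le (𝕜 := ℝ)
    (f := fun s => ‖t‖ ^ k • h s) (C := M) (fun s _ => (hdiff s).const_smul (‖t‖ ^ k))
    (fun s hs => by
      rw [fderiv_fun_const_smul (hdiff s), norm_smul, norm_pow, norm_norm]
      exact hM s hs)
    (Metric.mem_closedBall_self zero_le_one) (y := t - a) (by simpa using ha)
  simpa [← smul_sub, norm_smul] using this

variable (𝕜 : Type*) [RCLike 𝕜] [NormedSpace 𝕜 F]

lemma iteratedFDeriv_compSubConstCLM (g : 𝓢(E, F)) (n : ℕ) (a t : E) :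
    iteratedFDeriv ℝ n (compSubConstCLM 𝕜 a g) t = iteratedFDeriv ℝ n g (t - a) :=
  iteratedFDeriv_comp_sub n a t

variable [SMulCommClass ℝ 𝕜 F]

/-- The map sending `g` to the bounded function `t ↦ ‖t‖ ^ k • D^n g(t)`. -/
def weightedIteratedFDerivCLM (k n : ℕ) : 𝓢(E, F) →L[𝕜] BoundedMap E (E [×n]→L[ℝ] F) :=
  mkCLMtoNormedSpace
    (fun g => BoundedContinuousFunction.ofNormedAddCommGroup
      (fun t => ‖t‖ ^ k • iteratedFDeriv ℝ n g t)
      ((continuous_norm.pow k).smul (g.contDiff_iteratedFDeriv n (m := 0)).continuous)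
      (SchwartzMap.seminorm 𝕜 k n g)
      (fun t => by simpa [norm_smul] using g.le_seminorm 𝕜 k n t))
    (fun g h => by
      refine BoundedContinuousFunction.ext fun t => ?_
      simp [FunLike.coe_add, iteratedFDeriv_add_apply (g.contDiffAt n) (h.contDiffAt n)])
    (fun a g => by
      refine BoundedContinuousFunction.ext fun t => ?_
      simp [FunLike.coe_smul, iteratedFDeriv_const_smul_apply (g.contDiffAt n)]
      exact smul_comm _ _ _)
    ⟨{(k, n)}, 1, zero_le_one, fun g => by
      simpa using BoundedContinuousFunction.norm_ofNormedAddCommGroup_le _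
        (apply_nonneg (SchwartzMap.seminorm 𝕜 k n) g) _⟩

@[simp]
lemma weightedIteratedFDerivCLM_apply (k n : ℕ) (g : 𝓢(E, F)) (t : E) :
    weightedIteratedFDerivCLM 𝕜 k n g t = ‖t‖ ^ k • iteratedFDeriv ℝ n g t :=
  rfl

lemma norm_weightedIteratedFDerivCLM (k n : ℕ) (g : 𝓢(E, F)) :
    ‖weightedIteratedFDerivCLM 𝕜 k n g‖ = SchwartzMap.seminorm 𝕜 k n g := by
  refine le_antisymm ?_ ?_
  · rw [BoundedContinuousFunction.norm_le (apply_nonneg _ g)]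
    intro t
    simpa [norm_smul] using g.le_seminorm 𝕜 k n t
  · refine g.seminorm_le_bound 𝕜 k n (norm_nonneg _) fun t => ?_
    simpa [norm_smul] using (weightedIteratedFDerivCLM 𝕜 k n g).norm_coe_le_norm t

/-- A tempered distribution factors through finitely many weighted derivatives. -/
lemma exists_strongDual_weightedIteratedFDerivCLM (f : 𝓢(E, F) →L[𝕜] 𝕜) :
    ∃ (s : Finset (ℕ × ℕ)) (L : StrongDual 𝕜 (∀ p : s, BoundedMap E (E [×p.1.2]→L[ℝ] F))),
      ∀ g, f g = L (fun p => weightedIteratedFDerivCLM 𝕜 p.1.1 p.1.2 g) := by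
  obtain ⟨s, C, -, hC⟩ := Seminorm.bound_of_continuous (schwartz_withSeminorms 𝕜 E F)
    ((normSeminorm 𝕜 𝕜).comp f.toLinearMap) (continuous_norm.comp f.continuous)
  let ι : 𝓢(E, F) →L[𝕜] (∀ p : s, BoundedMap E (E [×p.1.2]→L[ℝ] F)) :=
    ContinuousLinearMap.pi fun p => weightedIteratedFDerivCLM 𝕜 p.1.1 p.1.2
  have hι (g : 𝓢(E, F)) : ‖f g‖ ≤ C * ‖ι g‖ := by
    refine (hC g).trans ?_
    rw [smul_apply, NNReal.smul_def, smul_eq_mul]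
    gcongr
    refine Seminorm.finset_sup_apply_le (norm_nonneg _) fun p hp => ?_
    rw [schwartzSeminormFamily_apply, ← norm_weightedIteratedFDerivCLM]
    exact norm_le_pi_norm (ι g) ⟨p, hp⟩
  have hker : LinearMap.ker ι.toLinearMap ≤ LinearMap.ker f.toLinearMap := fun g hg => by
    have h₀ : ι g = 0 := hg
    have h₁ := hι g
    rw [h₀, norm_zero, mul_zero] at h₁
    exact norm_le_zero_iff.1 h₁
  let f₀ : LinearMap.range ι.toLinearMap →ₗ[𝕜] 𝕜 :=
    (LinearMap.ker ι.toLinearMap).liftQ f.toLinearMap hker ∘ₗ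
      ι.toLinearMap.quotKerEquivRange.symm.toLinearMap
  have hf₀ (g : 𝓢(E, F)) (h) : f₀ ⟨ι g, h⟩ = f g := by
    have : ι.toLinearMap.quotKerEquivRange.symm ⟨ι g, h⟩ = Submodule.Quotient.mk g := by
      rw [LinearEquiv.symm_apply_eq]
      rfl
    simp [f₀, this]
  obtain ⟨L, hL, -⟩ := exists_extension_norm_eq (LinearMap.range ι.toLinearMap)
    (f₀.mkContinuous C (by
      rintro ⟨_, g, rfl⟩
      exact (congrArg norm (hf₀ g ⟨g, rfl⟩)).trans_le (hι g)))
  exact ⟨s, L, fun g => by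
    rw [← hf₀ g ⟨g, rfl⟩]; exact (hL ⟨ι g, ⟨g, rfl⟩⟩).symm⟩

section Integral

variable {α : Type*} [TopologicalSpace α] [MeasurableSpace α] [OpensMeasurableSpace α]
  [SecondCountableTopology α] {μ : Measure α}

lemma integrable_weightedIteratedFDerivCLM {G : α → 𝓢(E, F)} (hG : Continuous G) {k n : ℕ}
    (hint : Integrable (fun a => SchwartzMap.seminorm 𝕜 k n (G a)) μ) :
    Integrable (fun a => weightedIteratedFDerivCLM 𝕜 k n (G a)) μ :=
  hint.mono' ((weightedIteratedFDerivCLM 𝕜 k n).continuous.comp hG).aestronglyMeasurable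
    (.of_forall fun _ => (norm_weightedIteratedFDerivCLM 𝕜 k n _).le)

lemma integrable_iteratedFDeriv {G : α → 𝓢(E, F)} (hG : Continuous G) {n : ℕ}
    (hint : Integrable (fun a => SchwartzMap.seminorm 𝕜 0 n (G a)) μ) (t : E) :
    Integrable (fun a => iteratedFDeriv ℝ n (G a) t) μ := by
  simpa using (BoundedContinuousFunction.evalCLM 𝕜 t).integrable_comp
    (integrable_weightedIteratedFDerivCLM 𝕜 hG hint)

lemma iteratedFDeriv_integral {G : α → 𝓢(E, F)} (hG : Continuous G)
    (hint : ∀ n, Integrable (fun a => SchwartzMap.seminorm 𝕜 0 n (G a)) μ) (n : ℕ) :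
    iteratedFDeriv ℝ n (fun t => ∫ a, G a t ∂μ) = fun t => ∫ a, iteratedFDeriv ℝ n (G a) t ∂μ := by
  induction n with
  | zero =>
    ext1 t
    simp only [iteratedFDeriv_zero_eq_comp, Function.comp_apply]
    exact ((continuousMultilinearCurryFin0 ℝ E F).symm.toContinuousLinearEquiv
      |>.integral_comp_comm (fun a => G a t)).symm
  | succ n ih =>
    ext1 t
    rw [iteratedFDeriv_succ_eq_comp_left, ih]
    let e := continuousMultilinearCurryLeftEquiv ℝ (fun _ : Fin (n + 1) => E) F
    have hmeas : AEStronglyMeasurable (fun a => fderiv ℝ (iteratedFDeriv ℝ n (G a)) t) μ := by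
      have he (a : α) : fderiv ℝ (iteratedFDeriv ℝ n (G a)) t =
          e (iteratedFDeriv ℝ (n + 1) (G a) t) := (e.apply_symm_apply _).symm
      simp_rw [he]
      exact e.continuous.comp_aestronglyMeasurable
        (integrable_iteratedFDeriv 𝕜 hG (hint (n + 1)) t).aestronglyMeasurable
    have hder : HasFDerivAt (fun t => ∫ a, iteratedFDeriv ℝ n (G a) t ∂μ)
        (∫ a, fderiv ℝ (iteratedFDeriv ℝ n (G a)) t ∂μ) t := by
      refine hasFDerivAt_integral_of_dominated_of_fderiv_le (s := Set.univ)
        (F' := fun t a => fderiv ℝ (iteratedFDeriv ℝ n (G a)) t) univ_mem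
        (.of_forall fun t => (integrable_iteratedFDeriv 𝕜 hG (hint n) t).aestronglyMeasurable)
        (integrable_iteratedFDeriv 𝕜 hG (hint n) t) hmeas
        (.of_forall fun a t _ => ?_) (hint (n + 1)) (.of_forall fun a t _ => ?_)
      · simpa using norm_fderiv_iteratedFDeriv_le 𝕜 (G a) 0 n t
      · exact ((G a).contDiff_iteratedFDeriv n (m := 1)).differentiable (by simp) t |>.hasFDerivAt
    rw [Function.comp_apply, hder.fderiv]
    exact (ContinuousLinearEquiv.integral_comp_comm (𝕜 := ℝ) (E := E →L[ℝ] E [×n]→L[ℝ] F)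
      (F := E [×(n + 1)]→L[ℝ] F) (μ := μ)
      e.symm.toContinuousLinearEquiv (fun a => fderiv ℝ (iteratedFDeriv ℝ n (G a)) t)).symm

/-- Continuous functionals commute with absolutely convergent integrals of Schwartz functions. -/
theorem integrable_and_integral_comp_comm [CompleteSpace F] (f : 𝓢(E, F) →L[𝕜] 𝕜) {G : α → 𝓢(E, F)}
    (hG : Continuous G)
    (hint : ∀ k n, Integrable (fun a => SchwartzMap.seminorm 𝕜 k n (G a)) μ)
    {w : 𝓢(E, F)} (hw : ∀ t, w t = ∫ a, G a t ∂μ) :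
    Integrable (fun a => f (G a)) μ ∧ ∫ a, f (G a) ∂μ = f w := by
  obtain ⟨s, L, hL⟩ := exists_strongDual_weightedIteratedFDerivCLM 𝕜 f
  have hι : Integrable (fun a (p : s) => weightedIteratedFDerivCLM 𝕜 p.1.1 p.1.2 (G a)) μ :=
    Integrable.of_eval fun p => integrable_weightedIteratedFDerivCLM 𝕜 hG (hint _ _)
  simp only [hL]
  refine ⟨L.integrable_comp hι, ?_⟩
  rw [L.integral_comp_comm hι]
  congr 1
  ext1 p
  rw [eval_integral fun p => integrable_weightedIteratedFDerivCLM 𝕜 hG (hint _ _)]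
  ext1 t
  have h := (BoundedContinuousFunction.evalCLM 𝕜 t).integral_comp_comm
    (integrable_weightedIteratedFDerivCLM 𝕜 hG (hint p.1.1 p.1.2))
  simp only [BoundedContinuousFunction.evalCLM_apply, weightedIteratedFDerivCLM_apply] at h
  rw [← h, integral_smul, weightedIteratedFDerivCLM_apply, funext hw,
    iteratedFDeriv_integral 𝕜 hG (hint 0)]

end Integral

section Translation

lemma seminorm_compSubConstCLM_le (g : 𝓢(E, F)) (k n : ℕ) (a : E) :
    SchwartzMap.seminorm 𝕜 k n (compSubConstCLM 𝕜 a g) ≤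
      2 ^ (k - 1) * (SchwartzMap.seminorm 𝕜 k n g + ‖a‖ ^ k * SchwartzMap.seminorm 𝕜 0 n g) := by
  refine seminorm_le_bound 𝕜 k n _ (by positivity) fun t => ?_
  rw [iteratedFDeriv_compSubConstCLM]
  have h₁ := norm_add_pow_le k (t - a) a
  rw [sub_add_cancel] at h₁
  have h₂ := g.le_seminorm 𝕜 k n (t - a)
  have h₃ := g.le_seminorm 𝕜 0 n (t - a)
  rw [pow_zero, one_mul] at h₃
  calc ‖t‖ ^ k * ‖iteratedFDeriv ℝ n g (t - a)‖
      ≤ 2 ^ (k - 1) * (‖t - a‖ ^ k + ‖a‖ ^ k) * ‖iteratedFDeriv ℝ n g (t - a)‖ := by gcongr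
    _ = 2 ^ (k - 1) * (‖t - a‖ ^ k * ‖iteratedFDeriv ℝ n g (t - a)‖ +
          ‖a‖ ^ k * ‖iteratedFDeriv ℝ n g (t - a)‖) := by ring
    _ ≤ _ := by gcongr

lemma seminorm_compSubConstCLM_sub_le (g : 𝓢(E, F)) (k n : ℕ) {a : E} (ha : ‖a‖ ≤ 1) :
    SchwartzMap.seminorm 𝕜 k n (compSubConstCLM 𝕜 a g - g) ≤
      2 ^ (k - 1) * (SchwartzMap.seminorm 𝕜 k (n + 1) g + SchwartzMap.seminorm 𝕜 0 (n + 1) g) *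
        ‖a‖ := by
  refine seminorm_le_bound 𝕜 k n _ (by positivity) fun t => ?_
  set M := 2 ^ (k - 1) * (SchwartzMap.seminorm 𝕜 k (n + 1) g + SchwartzMap.seminorm 𝕜 0 (n + 1) g)
  have hsub : iteratedFDeriv ℝ n (compSubConstCLM 𝕜 a g - g) t =
      iteratedFDeriv ℝ n g (t - a) - iteratedFDeriv ℝ n g t := by
    rw [← iteratedFDeriv_compSubConstCLM 𝕜, FunLike.coe_sub,
      iteratedFDeriv_sub_apply (contDiffAt _ n) (contDiffAt _ n)]
  have hdiff := (g.contDiff_iteratedFDeriv n (m := 1)).differentiable (by simp)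
  rw [hsub]
  refine pow_mul_norm_sub_le hdiff (fun s hs => ?_) ha
  have h₁ := norm_add_pow_le k s (t - s)
  rw [add_sub_cancel] at h₁
  have h₂ := norm_fderiv_iteratedFDeriv_le 𝕜 g k n s
  have h₃ := norm_fderiv_iteratedFDeriv_le 𝕜 g 0 n s
  rw [pow_zero, one_mul] at h₃
  have h₄ : ‖t - s‖ ^ k ≤ 1 := pow_le_one₀ (norm_nonneg _) (by
    rwa [← dist_eq_norm, dist_comm])
  calc ‖t‖ ^ k * ‖fderiv ℝ (iteratedFDeriv ℝ n g) s‖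
      ≤ 2 ^ (k - 1) * (‖s‖ ^ k + 1) * ‖fderiv ℝ (iteratedFDeriv ℝ n g) s‖ :=
        mul_le_mul_of_nonneg_right (h₁.trans (by gcongr))
          (ContinuousLinearMap.opNorm_nonneg _)
    _ = 2 ^ (k - 1) * (‖s‖ ^ k * ‖fderiv ℝ (iteratedFDeriv ℝ n g) s‖ +
          ‖fderiv ℝ (iteratedFDeriv ℝ n g) s‖) := by ring
    _ ≤ M := mul_le_mul_of_nonneg_left (add_le_add h₂ h₃) (by positivity)

lemma continuous_compSubConstCLM (g : 𝓢(E, F)) :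
    Continuous fun a : E => compSubConstCLM 𝕜 a g := by
  have h₀ : Tendsto (fun a : E => compSubConstCLM 𝕜 a g) (𝓝 0) (𝓝 g) := by
    rw [(schwartz_withSeminorms 𝕜 E F).tendsto_nhds]
    rintro ⟨k, n⟩ ε hε
    have : Tendsto (fun a : E => 2 ^ (k - 1) *
        (SchwartzMap.seminorm 𝕜 k (n + 1) g + SchwartzMap.seminorm 𝕜 0 (n + 1) g) * ‖a‖)
        (𝓝 0) (𝓝 0) :=
      Continuous.tendsto' (by fun_prop) _ _ (by simp)
    filter_upwards [this.eventually_lt_const hε, Metric.closedBall_mem_nhds (0 : E) one_pos]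
      with a h₁ h₂
    exact (seminorm_compSubConstCLM_sub_le 𝕜 g k n (by simpa using h₂)).trans_lt h₁
  refine continuous_iff_continuousAt.2 fun b => ?_
  have hb : Tendsto (fun a : E => a - b) (𝓝 b) (𝓝 0) :=
    Continuous.tendsto' (by fun_prop) _ _ (by simp)
  simpa [Function.comp_def, compSubConstCLM_comp, ContinuousAt] using
    ((compSubConstCLM 𝕜 b).continuous.tendsto g).comp (h₀.comp hb)

end Translation

section Measure

variable [MeasurableSpace E] [BorelSpace E] [SecondCountableTopology E] {μ : Measure E}
  [μ.HasTemperateGrowth]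

lemma integrable_seminorm_smul_compSubConstCLM (g : 𝓢(E, F)) {H : Type*} [NormedAddCommGroup H]
    [NormedSpace ℝ H] (ψ : 𝓢(E, H)) {c : E → 𝕜} (hc : Continuous c) (hcψ : ∀ y, ‖c y‖ = ‖ψ y‖)
    (k n : ℕ) :
    Integrable (fun y => SchwartzMap.seminorm 𝕜 k n (c y • compSubConstCLM 𝕜 (-y) g)) μ := by
  have hcont : Continuous fun y => c y • compSubConstCLM 𝕜 (-y) g :=
    hc.smul ((continuous_compSubConstCLM 𝕜 g).comp continuous_neg)
  have hsemi : Continuous (SchwartzMap.seminorm 𝕜 k n : 𝓢(E, F) → ℝ) :=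
    (schwartz_withSeminorms 𝕜 E F).continuous_seminorm (k, n)
  refine (((ψ.integrable_pow_mul μ 0).const_mul (2 ^ (k - 1) * SchwartzMap.seminorm 𝕜 k n g)).add
    ((ψ.integrable_pow_mul μ k).const_mul (2 ^ (k - 1) * SchwartzMap.seminorm 𝕜 0 n g))).mono'
    (hsemi.comp hcont).aestronglyMeasurable (.of_forall fun y => ?_)
  rw [Real.norm_of_nonneg (apply_nonneg _ _), map_smul_eq_mul, hcψ]
  have h := seminorm_compSubConstCLM_le 𝕜 g k n (-y)
  rw [norm_neg] at h
  refine (mul_le_mul_of_nonneg_left h (norm_nonneg _)).trans_eq ?_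
  simp only [Pi.add_apply]
  ring

end Measure

end General

end SchwartzMap

/-- STFT with convolved window: V_{φ₁ * φ̃₂} f(x,ξ) = ∫ V_{φ₁}f(x−y,ξ) φ₂(y) dy, the
integral converging absolutely. Here φ̃₂(x) = conj(φ₂(−x)), `w₁ x ξ` is the window for φ₁
and `w x ξ` the window for the convolution φ₁ * φ̃₂. -/
theorem stmt6 (d : ℕ) (f : SchwartzMap (Ed d) ℂ →L[ℂ] ℂ)
    (φ₁ φ₂ : SchwartzMap (Ed d) ℂ)
    (w₁ w : Ed d → Ed d → SchwartzMap (Ed d) ℂ)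
    (hw₁ : ∀ x ξ y : Ed d,
      w₁ x ξ y = (starRingEnd ℂ) (φ₁ (y - x)) * Complex.exp (-(Complex.I * (⟪y, ξ⟫ : ℝ))))
    (hw : ∀ x ξ y : Ed d,
      w x ξ y = (starRingEnd ℂ) (∫ z : Ed d, φ₁ (y - x - z) * (starRingEnd ℂ) (φ₂ (-z))) *
        Complex.exp (-(Complex.I * (⟪y, ξ⟫ : ℝ))))
    (V₁ : Ed d → Ed d → ℂ)
    (hV₁ : ∀ x ξ : Ed d, V₁ x ξ = (((2 * π) ^ (-(d : ℝ) / 2) : ℝ) : ℂ) * f (w₁ x ξ)) :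
    ∀ x ξ : Ed d,
      Integrable (fun y : Ed d => V₁ (x - y) ξ * φ₂ y) ∧
      (((2 * π) ^ (-(d : ℝ) / 2) : ℝ) : ℂ) * f (w x ξ)
        = ∫ y : Ed d, V₁ (x - y) ξ * φ₂ y := by
  intro x ξ
  let c : Ed d → ℂ := fun y => φ₂ y * Complex.exp (Complex.I * (⟪y, ξ⟫ : ℝ))
  let G : Ed d → SchwartzMap (Ed d) ℂ := fun y =>
    c y • SchwartzMap.compSubConstCLM ℂ (-y) (w₁ x ξ)
  have hc : Continuous c := by
    have := φ₂.continuous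
    fun_prop
  have hG : Continuous G :=
    hc.smul ((SchwartzMap.continuous_compSubConstCLM ℂ (w₁ x ξ)).comp continuous_neg)
  have hwG (y : Ed d) : φ₂ y • w₁ (x - y) ξ = G y := by
    ext t
    have hexp : Complex.exp (-(Complex.I * (⟪t, ξ⟫ : ℝ))) =
        Complex.exp (Complex.I * (⟪y, ξ⟫ : ℝ)) *
          Complex.exp (-(Complex.I * (⟪t + y, ξ⟫ : ℝ))) := by
      rw [← Complex.exp_add, inner_add_left]
      congr 1
      push_cast
      ring
    simp only [G, c, smul_apply, SchwartzMap.compSubConstCLM_apply, hw₁, smul_eq_mul,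
      sub_neg_eq_add, hexp]
    rw [show t - (x - y) = t + y - x by abel]
    ring
  obtain ⟨hint, heq⟩ := SchwartzMap.integrable_and_integral_comp_comm ℂ (μ := volume) f hG
    (SchwartzMap.integrable_seminorm_smul_compSubConstCLM ℂ (w₁ x ξ) φ₂ hc fun y => by
      simp [c, Complex.norm_exp]) (w := w x ξ) fun t => by
      simp only [hw, ← hwG, smul_apply, hw₁, smul_eq_mul, ← integral_conj, ← integral_mul_const]
      rw [← integral_neg_eq_self]
      refine integral_congr_ae (.of_forall fun y => ?_)
      simp only [map_mul, Complex.conj_conj, neg_neg, sub_neg_eq_add]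
      rw [show t - x + y = t - (x - y) by abel]
      ring
  have hV (y : Ed d) : V₁ (x - y) ξ * φ₂ y =
      (((2 * π) ^ (-(d : ℝ) / 2) : ℝ) : ℂ) * f (G y) := by
    rw [hV₁, ← hwG, map_smul, smul_eq_mul]
    ring
  simp only [hV]
  exact ⟨hint.const_mul _, by rw [integral_const_mul, heq]⟩

end
end

section
/- Let h ∈ S(ℝ^{2d}) and define K(x,y) = (2π)^{-d} ∫_{ℝ^d} h(x,ξ) e^{i⟨x−y,ξ⟩} dξ. Then K ∈ S(ℝ^{2d}), and for every tempered distribution f ∈ S'(ℝ^d) the function x ↦ ⟨f, y ↦ K(x,y)⟩ belongs to S(ℝ^d). Moreover, for f ∈ S(ℝ^d) this function coincides with Op(h)f. -/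
open MeasureTheory Real Complex
open scoped RealInnerProductSpace

noncomputable section

namespace SchwartzMap

open scoped SchwartzMap LineDeriv ContDiff

variable {D E F X : Type*} [NormedAddCommGroup D] [NormedSpace ℝ D]
  [NormedAddCommGroup E] [NormedSpace ℝ E] [NormedAddCommGroup F] [NormedSpace ℝ F]
  [NormedAddCommGroup X] [NormedSpace ℝ X]

/-- A family of differentiable, rapidly decreasing functions that is stable under directional
derivatives consists of Schwartz functions. -/
theorem exists_eq_of_stable_fderiv [FiniteDimensional ℝ X] (P : Set (X → F))
    (hdiff : ∀ f ∈ P, Differentiable ℝ f)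
    (hderiv : ∀ f ∈ P, ∀ w, (fun x => fderiv ℝ f x w) ∈ P)
    (hdecay : ∀ f ∈ P, ∀ k : ℕ, ∃ C : ℝ, ∀ x, ‖x‖ ^ k * ‖f x‖ ≤ C) {f : X → F} (hf : f ∈ P) :
    ∃ g : 𝓢(X, F), ∀ x, g x = f x := by
  let b := Module.finBasis ℝ X
  let A := fun i => ContinuousLinearMap.smulRightL ℝ X F (LinearMap.toContinuousLinearMap (b.coord i))
  have hA : ∀ f : X → F, fderiv ℝ f = fun x => ∑ i, (A i ∘ fun x => fderiv ℝ f x (b i)) x := by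
    intro f
    funext x
    ext w
    conv_lhs => rw [← b.sum_repr w]
    simp [A, -Module.Basis.sum_repr]
  have key : ∀ n : ℕ, ∀ f ∈ P, ContDiff ℝ n f ∧
      ∀ k : ℕ, ∃ C : ℝ, ∀ x, ‖x‖ ^ k * ‖iteratedFDeriv ℝ n f x‖ ≤ C := by
    intro n
    induction n with
    | zero =>
      intro f hf
      exact ⟨contDiff_zero.2 (hdiff f hf).continuous, by simpa using hdecay f hf⟩
    | succ n ih =>
      intro f hf
      have hg := fun i => ih _ (hderiv f hf (b i))
      have hAg : ∀ i, ContDiff ℝ n (A i ∘ fun x => fderiv ℝ f x (b i)) :=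
        fun i => (A i).contDiff.comp (hg i).1
      refine ⟨?_, fun k => ?_⟩
      · rw [Nat.cast_add, Nat.cast_one, contDiff_succ_iff_fderiv]
        refine ⟨hdiff f hf, by simp, ?_⟩
        rw [hA f]
        exact ContDiff.sum fun i _ => hAg i
      · choose C hC using fun i => (hg i).2 k
        refine ⟨∑ i, ‖A i‖ * C i, fun x => ?_⟩
        rw [← norm_iteratedFDeriv_fderiv, hA f,
          iteratedFDeriv_fun_sum_apply fun i _ => (hAg i).contDiffAt]
        calc _ ≤ ‖x‖ ^ k * ∑ i, ‖A i‖ * ‖iteratedFDeriv ℝ n (fun x => fderiv ℝ f x (b i)) x‖ := by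
              gcongr
              refine (norm_sum_le _ _).trans (Finset.sum_le_sum fun i _ => ?_)
              exact (A i).norm_iteratedFDeriv_comp_left (hg i).1.contDiffAt le_rfl
          _ ≤ _ := by
              rw [Finset.mul_sum]
              refine Finset.sum_le_sum fun i _ => ?_
              rw [mul_left_comm]
              gcongr
              exact hC i x
  exact ⟨⟨f, contDiff_infty.2 fun n => (key n f hf).1, fun k n => (key n f hf).2 k⟩, fun _ => rfl⟩

/-- Restriction of a Schwartz function on a product to the slice `{x} × E`. -/
def slice [NormedSpace ℂ F] (x : D) : 𝓢(D × E, F) →L[ℂ] 𝓢(E, F) :=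
  compCLM ℂ (g := fun ξ => (x, ξ))
    (by
      have h1 := (Function.HasTemperateGrowth.const (E := E) ((x, 0) : D × E)).add
        (ContinuousLinearMap.inr ℝ D E).hasTemperateGrowth
      convert h1 using 2
      simp)
    ⟨1, 1, fun ξ => by
      have : ‖ξ‖ ≤ ‖(x, ξ)‖ := le_max_right _ _
      linarith⟩

theorem slice_apply [NormedSpace ℂ F] (x : D) (h : 𝓢(D × E, F)) (ξ : E) :
    slice x h ξ = h (x, ξ) := rfl

theorem norm_iteratedFDeriv_comp_prodMk_le {f : D × E → F} {n : ℕ} (hf : ContDiff ℝ n f)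
    (x : D) (ξ : E) :
    ‖iteratedFDeriv ℝ n (fun η => f (x, η)) ξ‖ ≤ ‖iteratedFDeriv ℝ n f (x, ξ)‖ := by
  have h1 : (fun η => f (x, η)) = (fun z => f ((x, 0) + z)) ∘ ContinuousLinearMap.inr ℝ D E := by
    funext η
    simp
  rw [h1, ContinuousLinearMap.iteratedFDeriv_comp_right _ (n := n) (by fun_prop) _ le_rfl,
    iteratedFDeriv_comp_add_left]
  refine (ContinuousMultilinearMap.norm_compContinuousLinearMap_le _ _).trans ?_
  have h2 : ‖ContinuousLinearMap.inr ℝ D E‖ ≤ 1 := ContinuousLinearMap.norm_inr_le_one ℝ D E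
  simp only [Finset.prod_const, ContinuousLinearMap.inr_apply, Prod.mk_add_mk, add_zero, zero_add]
  exact mul_le_of_le_one_right (norm_nonneg _) (pow_le_one₀ (norm_nonneg _) h2)

/-- If every Schwartz seminorm of a family is bounded by a multiple of a weight `B`, then so is
every continuous seminorm. -/
theorem exists_seminorm_le_of_forall [NormedSpace ℂ F] {ι : Type*} {φ : ι → 𝓢(E, F)} {B : ι → ℝ}
    (hφ : ∀ k n : ℕ, ∃ C : ℝ, ∀ i, SchwartzMap.seminorm ℂ k n (φ i) ≤ C * B i)
    {q : Seminorm ℂ 𝓢(E, F)} (hq : Continuous q) : ∃ C : ℝ, ∀ i, q (φ i) ≤ C * B i := by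
  obtain ⟨s, C, -, hC⟩ := Seminorm.bound_of_continuous (schwartz_withSeminorms ℂ E F) q hq
  choose M hM using hφ
  refine ⟨C * ∑ p ∈ s, M p.1 p.2, fun i => (hC (φ i)).trans ?_⟩
  rw [smul_apply, NNReal.smul_def, smul_eq_mul, mul_assoc, Finset.sum_mul]
  gcongr
  refine (Seminorm.finset_sup_le_sum _ s (φ i)).trans ?_
  rw [sum_apply]
  exact Finset.sum_le_sum fun p _ => hM p.1 p.2 i

theorem exists_pow_mul_seminorm_slice_le [NormedSpace ℂ F] (h : 𝓢(D × E, F)) (m : ℕ)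
    {q : Seminorm ℂ 𝓢(E, F)} (hq : Continuous q) :
    ∃ C : ℝ, ∀ x : D, ‖x‖ ^ m * q (slice x h) ≤ C := by
  have h1 : ∀ k n : ℕ, ∃ C : ℝ, ∀ x : D,
      SchwartzMap.seminorm ℂ k n (((‖x‖ ^ m : ℝ) : ℂ) • slice x h) ≤ C * 1 := by
    intro k n
    refine ⟨SchwartzMap.seminorm ℂ (m + k) n h, fun x => ?_⟩
    rw [map_smul_eq_mul, mul_one, Complex.norm_real, norm_pow, norm_norm]
    by_cases hx : ‖x‖ ^ m = 0
    · rw [hx, zero_mul]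
      exact apply_nonneg _ _
    have hx' : 0 < ‖x‖ ^ m := lt_of_le_of_ne (by positivity) (Ne.symm hx)
    rw [← le_div_iff₀' hx']
    refine seminorm_le_bound ℂ k n _ (div_nonneg (apply_nonneg _ _) hx'.le) fun ξ => ?_
    rw [le_div_iff₀' hx']
    calc _ ≤ ‖(x, ξ)‖ ^ m * (‖(x, ξ)‖ ^ k * ‖iteratedFDeriv ℝ n h (x, ξ)‖) := by
          gcongr
          · exact le_max_left _ _
          · exact le_max_right _ _
          · exact norm_iteratedFDeriv_comp_prodMk_le (h.smooth n) x ξ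
      _ ≤ _ := by
          rw [← mul_assoc, ← pow_add]
          exact le_seminorm ℂ (m + k) n h _
  obtain ⟨C, hC⟩ := exists_seminorm_le_of_forall h1 hq
  refine ⟨C, fun x => ?_⟩
  have := hC x
  rwa [map_smul_eq_mul, mul_one, Complex.norm_real, norm_pow, norm_norm] at this

theorem lineDerivOp_comm (h : 𝓢(X, F)) (v w : X) :
    (∂_{v} (∂_{w} h) : 𝓢(X, F)) = ∂_{w} (∂_{v} h) := by
  have h1 : ∀ v w z : X, (∂_{v} (∂_{w} h) : 𝓢(X, F)) z = fderiv ℝ (fderiv ℝ h) z v w := by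
    intro v w z
    have h2 : DifferentiableAt ℝ (fderiv ℝ h) z := (fderivCLM ℝ X F h).differentiableAt
    rw [lineDerivOp_apply_eq_fderiv]
    change fderiv ℝ (fun y => fderiv ℝ h y w) z v = _
    rw [fderiv_clm_apply h2 (differentiableAt_const w)]
    simp
  ext z
  rw [h1, h1]
  exact (h.contDiffAt 2).isSymmSndFDerivAt (by simp) v w

theorem lineDerivOp_iteratedLineDerivOp_comm (h : 𝓢(X, F)) {n : ℕ} (m : Fin n → X) (v : X) :
    (∂_{v} (∂^{m} h) : 𝓢(X, F)) = ∂^{m} (∂_{v} h) := by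
  induction n with
  | zero => simp
  | succ n ih =>
    rw [LineDeriv.iteratedLineDerivOp_succ_left, LineDeriv.iteratedLineDerivOp_succ_left,
      lineDerivOp_comm, ih]

theorem iteratedFDeriv_lineDerivOp (h : 𝓢(X, F)) (n : ℕ) (v z : X) :
    iteratedFDeriv ℝ n (∂_{v} h : 𝓢(X, F)) z = fderiv ℝ (iteratedFDeriv ℝ n h) z v := by
  refine ContinuousMultilinearMap.ext fun m => ?_
  rw [← iteratedLineDerivOp_eq_iteratedFDeriv, ← lineDerivOp_iteratedLineDerivOp_comm,
    lineDerivOp_apply_eq_fderiv, ← fderiv_continuousMultilinear_apply_const_apply]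
  · simp only [← iteratedLineDerivOp_eq_iteratedFDeriv]
  · exact (h.smooth ⊤).differentiable_iteratedFDeriv (mod_cast ENat.natCast_lt_top n) z

theorem norm_iteratedFDeriv_taylor_le (h : 𝓢(X, F)) (n : ℕ) {z v : X} {b : ℝ}
    (hb : ∀ y ∈ segment ℝ z (z + v), ‖iteratedFDeriv ℝ (n + 2) h y‖ ≤ b) :
    ‖iteratedFDeriv ℝ n h (z + v) - iteratedFDeriv ℝ n h z - fderiv ℝ (iteratedFDeriv ℝ n h) z v‖
      ≤ b * ‖v‖ ^ 2 := by
  have hd : ∀ (m : ℕ) (y : X), DifferentiableAt ℝ (iteratedFDeriv ℝ m h) y := fun m y =>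
    (h.smooth ⊤).differentiable_iteratedFDeriv (mod_cast ENat.natCast_lt_top m) y
  have hz := left_mem_segment ℝ z (z + v)
  have hb0 : 0 ≤ b := (norm_nonneg _).trans (hb z hz)
  have h1 : ∀ y ∈ segment ℝ z (z + v),
      ‖fderiv ℝ (iteratedFDeriv ℝ n h) y - fderiv ℝ (iteratedFDeriv ℝ n h) z‖ ≤ b * ‖v‖ := by
    intro y hy
    have h2 := (convex_segment z (z + v)).norm_image_sub_le_of_norm_fderiv_le
      (f := iteratedFDeriv ℝ (n + 1) h) (fun y _ => hd (n + 1) y)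
      (fun y hy => by rw [norm_fderiv_iteratedFDeriv]; exact hb y hy) hz hy
    rw [iteratedFDeriv_succ_eq_comp_left] at h2
    rw [Function.comp_apply, Function.comp_apply, ← dist_eq_norm, LinearIsometryEquiv.dist_map,
      dist_eq_norm] at h2
    refine h2.trans ?_
    gcongr
    simpa using norm_sub_le_of_mem_segment hy
  have h3 := (convex_segment z (z + v)).norm_image_sub_le_of_norm_fderiv_le'
    (fun y _ => hd n y) h1 hz (right_mem_segment ℝ z (z + v))
  rw [add_sub_cancel_left] at h3
  linarith [h3]

theorem exists_seminorm_slice_taylor_le [NormedSpace ℂ F] (h : 𝓢(D × E, F))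
    {q : Seminorm ℂ 𝓢(E, F)} (hq : Continuous q) :
    ∃ C : ℝ, ∀ x u : D,
      q (slice (x + u) h - slice x h - slice x (∂_{(u, (0 : E))} h)) ≤ C * ‖u‖ ^ 2 := by
  have h1 : ∀ k n : ℕ, ∃ C : ℝ, ∀ p : D × D, SchwartzMap.seminorm ℂ k n
      (slice (p.1 + p.2) h - slice p.1 h - slice p.1 (∂_{(p.2, (0 : E))} h)) ≤ C * ‖p.2‖ ^ 2 := by
    intro k n
    refine ⟨SchwartzMap.seminorm ℂ k (n + 2) h, fun ⟨x, u⟩ => ?_⟩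
    refine seminorm_le_bound ℂ k n _ (by positivity) fun ξ => ?_
    by_cases hξ : ‖ξ‖ ^ k = 0
    · rw [hξ, zero_mul]
      positivity
    have hξ' : 0 < ‖ξ‖ ^ k := lt_of_le_of_ne (by positivity) (Ne.symm hξ)
    let v : D × E := (u, 0)
    have hcd : ContDiff ℝ n h := h.smooth n
    have hcdv : ContDiff ℝ n (fun z => h (z + v)) := by fun_prop
    have hcdd : ContDiff ℝ n (∂_{v} h : 𝓢(D × E, F)) := (∂_{v} h).smooth n
    have h2 := norm_iteratedFDeriv_taylor_le h n (z := (x, ξ)) (v := v)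
      (b := SchwartzMap.seminorm ℂ k (n + 2) h / ‖ξ‖ ^ k) (by
        intro y hy
        have hy2 : y.2 = ξ := by
          obtain ⟨s, t, _, _, hst, rfl⟩ := hy
          simp [v, ← add_smul, hst]
        rw [le_div_iff₀' hξ']
        refine le_trans ?_ (le_seminorm ℂ k (n + 2) h y)
        gcongr
        rw [← hy2]
        exact le_max_right _ _)
    have h3 := norm_iteratedFDeriv_comp_prodMk_le
      (f := fun z => h (z + v) - h z - ∂_{v} h z) (n := n) (by fun_prop) x ξ
    have h7 : iteratedFDeriv ℝ n (fun z => h (z + v) - h z - ∂_{v} h z) (x, ξ) =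
        iteratedFDeriv ℝ n h ((x, ξ) + v) - iteratedFDeriv ℝ n h (x, ξ) -
          fderiv ℝ (iteratedFDeriv ℝ n h) (x, ξ) v := by
      rw [fun_iteratedFDeriv_sub_apply (by fun_prop) (by fun_prop),
        fun_iteratedFDeriv_sub_apply (by fun_prop) (by fun_prop), iteratedFDeriv_comp_add_right,
        iteratedFDeriv_lineDerivOp]
    rw [h7] at h3
    have h4 : ⇑(slice (x + u) h - slice x h - slice x (∂_{(u, (0 : E))} h)) =
        fun η => h ((x, η) + v) - h (x, η) - ∂_{v} h (x, η) := by
      funext η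
      simp [slice_apply, v]
    rw [h4]
    have h5 : ‖v‖ = ‖u‖ := by simp [v, Prod.norm_def]
    rw [h5] at h2
    have h6 := h3.trans h2
    rw [div_mul_eq_mul_div, le_div_iff₀' hξ'] at h6
    exact h6
  obtain ⟨C, hC⟩ := exists_seminorm_le_of_forall h1 hq
  exact ⟨C, fun x u => hC (x, u)⟩

/-- The pairing of a tempered distribution with the slices of a Schwartz function is
differentiable, and differentiation may be carried out on the Schwartz function. -/
theorem hasFDerivAt_slice [FiniteDimensional ℝ D] (T : 𝓢(E, ℂ) →L[ℂ] ℂ) (h : 𝓢(D × E, ℂ)) (x : D) :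
    ∃ L : D →L[ℝ] ℂ, (∀ u, L u = T (slice x (∂_{(u, (0 : E))} h))) ∧
      HasFDerivAt (fun x => T (slice x h)) L x := by
  let L₀ : D →ₗ[ℝ] ℂ :=
    { toFun := fun u => T (slice x (∂_{(u, (0 : E))} h))
      map_add' := fun u v => by
        rw [← map_add, ← map_add, ← LineDeriv.lineDerivOp_left_add, Prod.mk_add_mk, add_zero]
      map_smul' := fun r u => by
        have h1 : ((r • u, 0) : D × E) = r • (u, 0) := by simp
        rw [h1, LineDeriv.lineDerivOp_left_smul]
        have h2 : (r • ∂_{(u, (0 : E))} h : 𝓢(D × E, ℂ)) = (r : ℂ) • ∂_{(u, (0 : E))} h := by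
          ext z
          simp
        rw [h2, map_smul, map_smul]
        simp }
  refine ⟨LinearMap.toContinuousLinearMap L₀, fun _ => rfl, ?_⟩
  let q : Seminorm ℂ 𝓢(E, ℂ) := (normSeminorm ℂ ℂ).comp T.toLinearMap
  have hq : Continuous q := T.continuous.norm
  obtain ⟨C, hC⟩ := exists_seminorm_slice_taylor_le h hq
  rw [hasFDerivAt_iff_isLittleO_nhds_zero]
  have h1 : (fun u : D => T (slice (x + u) h) - T (slice x h) - LinearMap.toContinuousLinearMap L₀ u)
      =O[nhds 0] fun u : D => ‖u‖ ^ 2 := by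
    refine Asymptotics.IsBigO.of_bound C (Filter.Eventually.of_forall fun u => ?_)
    rw [norm_pow, norm_norm]
    refine le_trans (le_of_eq ?_) (hC x u)
    change _ = ‖T _‖
    rw [map_sub, map_sub]
    rfl
  exact h1.trans_isLittleO (Asymptotics.isLittleO_norm_pow_id one_lt_two)

theorem exists_eq_apply_slice [FiniteDimensional ℝ D] (T : 𝓢(E, ℂ) →L[ℂ] ℂ) (h : 𝓢(D × E, ℂ)) :
    ∃ g : 𝓢(D, ℂ), ∀ x, g x = T (slice x h) := by
  refine exists_eq_of_stable_fderiv (Set.range fun (h : 𝓢(D × E, ℂ)) (x : D) => T (slice x h))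
    ?_ ?_ ?_ ⟨h, rfl⟩
  · rintro _ ⟨h, rfl⟩ x
    obtain ⟨L, -, hL⟩ := hasFDerivAt_slice T h x
    exact hL.differentiableAt
  · rintro _ ⟨h, rfl⟩ u
    refine ⟨∂_{(u, (0 : E))} h, funext fun x => ?_⟩
    obtain ⟨L, hLu, hL⟩ := hasFDerivAt_slice T h x
    change _ = fderiv ℝ (fun x => T (slice x h)) x u
    rw [hL.fderiv, hLu]
  · rintro _ ⟨h, rfl⟩ k
    exact exists_pow_mul_seminorm_slice_le h k
      (q := (normSeminorm ℂ ℂ).comp T.toLinearMap) T.continuous.norm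

end SchwartzMap

namespace SchwartzMap

open scoped SchwartzMap FourierTransform

variable {D F V : Type*} [NormedAddCommGroup D] [NormedSpace ℝ D]
  [NormedAddCommGroup F] [NormedSpace ℝ F]
  [NormedAddCommGroup V] [InnerProductSpace ℝ V]

theorem exists_hasFDerivAt_fourierChar_mul (h : 𝓢(D × V, ℂ)) :
    ∃ k : 𝓢(D × V, D × V →L[ℝ] ℂ), ∀ (ξ : V) (p : D × V),
      HasFDerivAt (fun p : D × V => (𝐞 (-inner ℝ ξ p.2) : ℂ) * h (p.1, ξ))
        ((𝐞 (-inner ℝ ξ p.2) : ℂ) • k (p.1, ξ)) p := by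
  let L : V →L[ℝ] D × V →L[ℝ] ℝ :=
    (ContinuousLinearMap.compL ℝ (D × V) V ℝ).flip (ContinuousLinearMap.snd ℝ D V) ∘L innerSL ℝ
  let J : D × V →L[ℝ] D × V := ContinuousLinearMap.inl ℝ D V ∘L ContinuousLinearMap.fst ℝ D V
  refine ⟨postcompCLM (𝕜 := ℝ) ((ContinuousLinearMap.compL ℝ (D × V) (D × V) ℂ).flip J)
      (fderivCLM ℝ (D × V) ℂ h)
    + smulRightCLM ℝ ℂ (L ∘L ContinuousLinearMap.snd ℝ D V) ((-2 * π * I : ℂ) • h), fun ξ p => ?_⟩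
  have h1 := hasFDerivAt_fourierChar_neg_bilinear_right L ξ p
  have h2 : HasFDerivAt (fun p : D × V => h (p.1, ξ)) ((fderiv ℝ h (p.1, ξ)) ∘L J) p := by
    have h3 : HasFDerivAt (fun p : D × V => (p.1, ξ)) J p := by
      refine ((hasFDerivAt_fst (𝕜 := ℝ) (p := p)).prodMk (hasFDerivAt_const ξ p)).congr_fderiv ?_
      exact ContinuousLinearMap.ext fun w => rfl
    exact (h.differentiableAt (x := (p.1, ξ))).hasFDerivAt.comp p h3
  refine (h1.mul h2).congr_fderiv (ContinuousLinearMap.ext fun w => ?_)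
  have h4 : ∀ w, L ξ w = inner ℝ ξ w.2 := fun w => rfl
  have h5 : (smulRightCLM ℝ ℂ (L ∘L ContinuousLinearMap.snd ℝ D V) ((-2 * π * I : ℂ) • h)) (p.1, ξ)
      w = (inner ℝ ξ w.2 : ℝ) • ((-2 * π * I : ℂ) * h (p.1, ξ)) := rfl
  have h6 : (postcompCLM (𝕜 := ℝ) ((ContinuousLinearMap.compL ℝ (D × V) (D × V) ℂ).flip J)
      (fderivCLM ℝ (D × V) ℂ h)) (p.1, ξ) w = fderiv ℝ h (p.1, ξ) (J w) := rfl
  simp only [add_apply, smul_apply, h5, h6,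
    ContinuousLinearMap.comp_apply, h4, ofRealCLM_apply, smul_eq_mul, Complex.real_smul]
  ring

variable [FiniteDimensional ℝ V] [MeasurableSpace V] [BorelSpace V]

theorem exists_integrable_bound_slice (k : 𝓢(D × V, F)) :
    ∃ bound : V → ℝ, Integrable bound ∧ ∀ (x : D) (ξ : V), ‖k (x, ξ)‖ ≤ bound ξ := by
  let n := Module.finrank ℝ V + 1
  let C := 2 ^ n * ((Finset.Iic (n, 0)).sup fun m => SchwartzMap.seminorm ℝ m.1 m.2) k
  refine ⟨fun ξ => C * (1 + ‖ξ‖) ^ (-(n : ℝ)),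
    (integrable_one_add_norm (by simp [n])).const_mul C, fun x ξ => ?_⟩
  have h1 := one_add_le_sup_seminorm_apply (𝕜 := ℝ) (m := (n, 0)) le_rfl le_rfl k (x, ξ)
  rw [norm_iteratedFDeriv_zero] at h1
  have h2 : 0 < 1 + ‖ξ‖ := by positivity
  have h3 : ‖ξ‖ ≤ ‖(x, ξ)‖ := le_max_right _ _
  beta_reduce
  rw [Real.rpow_neg h2.le, Real.rpow_natCast, ← div_eq_mul_inv, le_div_iff₀' (by positivity)]
  refine le_trans ?_ h1
  gcongr

/-- The partial Fourier transform in the second variable. -/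
def partialFourier (h : 𝓢(D × V, ℂ)) (p : D × V) : ℂ :=
  ∫ ξ : V, (𝐞 (-inner ℝ ξ p.2) : ℂ) * h (p.1, ξ)

theorem partialFourier_eq (h : 𝓢(D × V, ℂ)) (p : D × V) :
    partialFourier h p = 𝓕 (slice p.1 h) p.2 := by
  rw [fourier_coe, Real.fourier_eq]
  rfl

theorem integrable_fourierChar_smul_slice [NormedSpace ℂ F] (g : 𝓢(D × V, F)) (p : D × V) :
    Integrable fun ξ : V => (𝐞 (-inner ℝ ξ p.2) : ℂ) • g (p.1, ξ) := by
  obtain ⟨bound, hb, hgb⟩ := exists_integrable_bound_slice g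
  refine hb.mono' ?_ (Filter.Eventually.of_forall fun ξ => ?_)
  · have hc : Continuous fun ξ : V => (𝐞 (-inner ℝ ξ p.2) : ℂ) := by fun_prop
    exact (hc.smul (g.continuous.comp (by fun_prop))).aestronglyMeasurable
  · rw [norm_smul, Circle.norm_coe, one_mul]
    exact hgb p.1 ξ

set_option maxSynthPendingDepth 5 in
theorem hasFDerivAt_partialFourier (h : 𝓢(D × V, ℂ)) :
    ∃ k : 𝓢(D × V, D × V →L[ℝ] ℂ), ∀ p : D × V,
      HasFDerivAt (partialFourier h) (∫ ξ : V, (𝐞 (-inner ℝ ξ p.2) : ℂ) • k (p.1, ξ)) p := by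
  obtain ⟨k, hk⟩ := exists_hasFDerivAt_fourierChar_mul h
  refine ⟨k, fun p => ?_⟩
  obtain ⟨bound, hb, hkb⟩ := exists_integrable_bound_slice k
  have hm : ∀ᶠ q in nhds p, AEStronglyMeasurable
      (fun ξ : V => (𝐞 (-inner ℝ ξ q.2) : ℂ) • h (q.1, ξ)) volume :=
    Filter.Eventually.of_forall fun q =>
      (integrable_fourierChar_smul_slice h q).aestronglyMeasurable
  have hk' := (integrable_fourierChar_smul_slice k p).aestronglyMeasurable
  have hkb' : ∀ᵐ ξ : V, ∀ q ∈ (Set.univ : Set (D × V)),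
      ‖(𝐞 (-inner ℝ ξ q.2) : ℂ) • k (q.1, ξ)‖ ≤ bound ξ := by
    refine Filter.Eventually.of_forall fun ξ q _ => ?_
    rw [norm_smul, Circle.norm_coe, one_mul]
    exact hkb q.1 ξ
  have hd : ∀ᵐ ξ : V, ∀ q ∈ (Set.univ : Set (D × V)),
      HasFDerivAt (fun p : D × V => (𝐞 (-inner ℝ ξ p.2) : ℂ) * h (p.1, ξ))
        ((𝐞 (-inner ℝ ξ q.2) : ℂ) • k (q.1, ξ)) q :=
    Filter.Eventually.of_forall fun ξ p _ => hk ξ p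
  exact hasFDerivAt_integral_of_dominated_of_fderiv_le (𝕜 := ℝ) (E := ℂ) (H := D × V)
    Filter.univ_mem hm (integrable_fourierChar_smul_slice h p) hk' hkb' hb hd

set_option maxSynthPendingDepth 5 in
theorem exists_eq_partialFourier [FiniteDimensional ℝ D] (h : 𝓢(D × V, ℂ)) :
    ∃ g : 𝓢(D × V, ℂ), ∀ p, g p = partialFourier h p := by
  refine exists_eq_of_stable_fderiv (Set.range (partialFourier (D := D) (V := V))) ?_ ?_ ?_ ⟨h, rfl⟩
  · rintro _ ⟨h, rfl⟩ p
    obtain ⟨k, hk⟩ := hasFDerivAt_partialFourier h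
    exact (hk p).differentiableAt
  · rintro _ ⟨h, rfl⟩ w
    obtain ⟨k, hk⟩ := hasFDerivAt_partialFourier h
    refine ⟨SchwartzMap.evalCLM ℝ (D × V) ℂ w k, funext fun p => ?_⟩
    rw [(hk p).fderiv,
      ContinuousLinearMap.integral_apply (integrable_fourierChar_smul_slice k p)]
    rfl
  · rintro _ ⟨h, rfl⟩ k
    let T : 𝓢(V, ℂ) →L[ℂ] 𝓢(V, ℂ) := fourierTransformCLM ℂ
    let q : ℕ → Seminorm ℂ 𝓢(V, ℂ) := fun j => (SchwartzMap.seminorm ℂ j 0).comp T.toLinearMap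
    have hq : ∀ j, Continuous (q j) := fun j =>
      ((schwartz_withSeminorms ℂ V ℂ).continuous_seminorm (j, 0)).comp T.continuous
    obtain ⟨C₁, hC₁⟩ := exists_pow_mul_seminorm_slice_le h k (hq 0)
    obtain ⟨C₂, hC₂⟩ := exists_pow_mul_seminorm_slice_le h 0 (hq k)
    refine ⟨C₁ + C₂, fun p => ?_⟩
    rw [partialFourier_eq]
    have h1 : ‖p‖ ^ k ≤ ‖p.1‖ ^ k + ‖p.2‖ ^ k := by
      rcases max_choice ‖p.1‖ ‖p.2‖ with h2 | h2 <;> rw [Prod.norm_def, h2]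
      · exact le_add_of_nonneg_right (by positivity)
      · exact le_add_of_nonneg_left (by positivity)
    have h3 := norm_le_seminorm ℂ (T (slice p.1 h)) p.2
    have h4 := norm_pow_mul_le_seminorm ℂ (T (slice p.1 h)) k p.2
    calc _ ≤ (‖p.1‖ ^ k + ‖p.2‖ ^ k) * ‖T (slice p.1 h) p.2‖ := by
          gcongr
          exact le_rfl
      _ ≤ ‖p.1‖ ^ k * q 0 (slice p.1 h) + ‖p.1‖ ^ 0 * q k (slice p.1 h) := by
          rw [add_mul, pow_zero, one_mul]
          gcongr
          · exact h3
          · exact h4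
      _ ≤ _ := add_le_add (hC₁ _) (hC₂ _)

end SchwartzMap

section

open scoped SchwartzMap FourierTransform
open SchwartzMap

theorem exists_eq_kernel (d : ℕ) (h : 𝓢(Ed d × Ed d, ℂ)) :
    ∃ g : 𝓢(Ed d × Ed d, ℂ), ∀ x y : Ed d,
      g (x, y) = ∫ ξ : Ed d, h (x, ξ) * Complex.exp (Complex.I * (⟪x - y, ξ⟫ : ℝ)) := by
  have hpi : (2 * π : ℝ) ≠ 0 := by positivity
  obtain ⟨g, hg⟩ := exists_eq_partialFourier h
  let e : (Ed d × Ed d) ≃L[ℝ] (Ed d × Ed d) := ContinuousLinearEquiv.equivOfInverse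
    ((ContinuousLinearMap.fst ℝ _ _).prod ((2 * π)⁻¹ •
      (ContinuousLinearMap.snd ℝ _ _ - ContinuousLinearMap.fst ℝ _ _)))
    ((ContinuousLinearMap.fst ℝ _ _).prod
      ((2 * π) • ContinuousLinearMap.snd ℝ _ _ + ContinuousLinearMap.fst ℝ _ _))
    (fun p => Prod.ext rfl (by simp [-mul_inv_rev, smul_smul, hpi]))
    (fun p => Prod.ext rfl (by simp [-mul_inv_rev, smul_smul, hpi]))
  refine ⟨compCLMOfContinuousLinearEquiv ℂ e g, fun x y => ?_⟩
  change g (x, (2 * π)⁻¹ • (y - x)) = _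
  rw [hg]
  refine integral_congr_ae (Filter.Eventually.of_forall fun ξ => ?_)
  beta_reduce
  rw [mul_comm, Real.fourierChar_apply, inner_smul_right, real_inner_comm, ← neg_sub x y,
    inner_neg_left, mul_neg _ ⟪x - y, ξ⟫, neg_neg, mul_inv_cancel_left₀ hpi, mul_comm Complex.I]

theorem integral_kernel_mul_eq_opKN {d : ℕ} (h : 𝓢(Ed d × Ed d, ℂ)) (f : 𝓢(Ed d, ℂ)) (x : Ed d) :
    ∫ y : Ed d, (((2 * π) ^ (-(d : ℝ)) : ℝ) : ℂ) *
        (∫ ξ : Ed d, h (x, ξ) * Complex.exp (Complex.I * (⟪x - y, ξ⟫ : ℝ))) * f y =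
      OpKN h f x := by
  have hint : Integrable (Function.uncurry fun (y ξ : Ed d) =>
      h (x, ξ) * Complex.exp (Complex.I * (⟪x - y, ξ⟫ : ℝ)) * f y) (volume.prod volume) := by
    refine (f.integrable.mul_prod (slice x h).integrable).mono ?_ ?_
    · refine Continuous.aestronglyMeasurable ?_
      have h1 := h.continuous
      have h2 := f.continuous
      unfold Function.uncurry
      fun_prop
    · refine Filter.Eventually.of_forall fun p => ?_
      rw [Function.uncurry, norm_mul, norm_mul, mul_comm Complex.I, Complex.norm_exp_ofReal_mul_I,
        mul_one, norm_mul, mul_comm, slice_apply]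
  have hpow : (((2 * π) ^ (-(d : ℝ)) : ℝ) : ℂ) =
      (((2 * π) ^ (-(d : ℝ) / 2) : ℝ) : ℂ) * (((2 * π) ^ (-(d : ℝ) / 2) : ℝ) : ℂ) := by
    rw [← Complex.ofReal_mul, ← Real.rpow_add (by positivity), add_halves]
  simp_rw [mul_assoc (((2 * π) ^ (-(d : ℝ)) : ℝ) : ℂ), ← integral_mul_const]
  rw [integral_const_mul, integral_integral_swap hint, hpow, mul_assoc, OpKN, ← integral_const_mul]
  congr 1
  refine integral_congr_ae (Filter.Eventually.of_forall fun ξ => ?_)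
  beta_reduce
  rw [fourierInt, mul_left_comm, mul_assoc, mul_assoc, ← integral_mul_const, ← integral_const_mul,
    ← integral_const_mul, ← integral_const_mul]
  refine integral_congr_ae (Filter.Eventually.of_forall fun y => ?_)
  beta_reduce
  rw [inner_sub_left x y ξ, Complex.ofReal_sub, mul_sub, sub_eq_add_neg, Complex.exp_add]
  ring

end

/-- For h ∈ S(ℝ^{2d}), the kernel K(x,y) = (2π)^{-d} ∫ h(x,ξ) e^{i⟨x−y,ξ⟩} dξ is a Schwartz
function on ℝ^{2d}; pairing any tempered distribution with its slices yields a Schwartz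
function on ℝ^d, and for Schwartz f this pairing is Op(h)f. -/
theorem stmt18 (d : ℕ) (h : SchwartzMap (Ed d × Ed d) ℂ)
    (K : Ed d × Ed d → ℂ)
    (hK : ∀ x y : Ed d,
      K (x, y) = (((2 * π) ^ (-(d : ℝ)) : ℝ) : ℂ) *
        ∫ ξ : Ed d, h (x, ξ) * Complex.exp (Complex.I * (⟪x - y, ξ⟫ : ℝ))) :
    (∃ Ks : SchwartzMap (Ed d × Ed d) ℂ, ∀ p : Ed d × Ed d, Ks p = K p) ∧
    (∃ slice : Ed d → SchwartzMap (Ed d) ℂ,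
      (∀ x y : Ed d, slice x y = K (x, y)) ∧
      (∀ f : SchwartzMap (Ed d) ℂ →L[ℂ] ℂ,
        ∃ g : SchwartzMap (Ed d) ℂ, ∀ x : Ed d, g x = f (slice x))) ∧
    (∀ (f : SchwartzMap (Ed d) ℂ) (x : Ed d),
      (∫ y : Ed d, K (x, y) * f y) = OpKN (⇑h) (⇑f) x) := by
  obtain ⟨g, hg⟩ := exists_eq_kernel d h
  let Ks : SchwartzMap (Ed d × Ed d) ℂ := (((2 * π) ^ (-(d : ℝ)) : ℝ) : ℂ) • g
  have hKs : ∀ p : Ed d × Ed d, Ks p = K p := fun ⟨x, y⟩ => by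
    rw [hK, ← hg]
    rfl
  refine ⟨⟨Ks, hKs⟩, ⟨fun x => SchwartzMap.slice x Ks, fun x y => hKs (x, y),
    fun f => SchwartzMap.exists_eq_apply_slice f Ks⟩, fun f x => ?_⟩
  simp_rw [hK]
  exact integral_kernel_mul_eq_opKN h f x

end
end
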